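/- Let T ∈ ITM(r) be a stable map that satisfies conditions A1 and A2. Then for every dynamically non-trivial interval component J of X, the first return map R_J to J has exactly one discontinuity; that is, exactly one point of the interior of J lands on a discontinuity of T before returning to J. -/

import Mathlib

open Set Filter
open scoped Classical

/-- An interval translation map on `r ≥ 2` intervals: discontinuity points
`0 = β₀ < β₁ < ⋯ < β_{r−1} < β_r = 1` and translation parameters
`γ_i ∈ [−β_{i−1}, 1−β_i]`, acting by `T(x) = x + γ_i` for `x ∈ [β_{i−1}, β_i)`. -/
structure ITM (r : ℕ) : Type where
  beta : Fin (r + 1) → ℝ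
  gamma : Fin r → ℝ
  two_le_r : 2 ≤ r
  beta_zero : beta 0 = 0
  beta_last : beta (Fin.last r) = 1
  beta_mono : StrictMono beta
  gamma_mem : ∀ i : Fin r, gamma i ∈ Set.Icc (-(beta i.castSucc)) (1 - beta i.succ)

namespace ITM

variable {r : ℕ}

/-- The unit interval `I = [0,1)`. -/
def unitIco : Set ℝ := Set.Ico 0 1

/-- Index of the partition interval `I_i = [β_{i−1}, β_i)` containing `x`. -/
noncomputable def idx (T : ITM r) (x : ℝ) : Fin r :=
  if h : ∃ i : Fin r, x ∈ Set.Ico (T.beta i.castSucc) (T.beta i.succ) then h.choose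
  else ⟨0, by have := T.two_le_r; omega⟩

/-- The interval translation map itself (right-continuous version), extended by the
identity off `[0,1)`. -/
noncomputable def f (T : ITM r) (x : ℝ) : ℝ :=
  if x ∈ unitIco then x + T.gamma (T.idx x) else x

/-- Index of the partition interval `(β_{i−1}, β_i]` containing `x` (left-limit version). -/
noncomputable def idxm (T : ITM r) (x : ℝ) : Fin r :=
  if h : ∃ i : Fin r, x ∈ Set.Ioc (T.beta i.castSucc) (T.beta i.succ) then h.choose
  else ⟨0, by have := T.two_le_r; omega⟩

/-- The left-limit version of `T`: `T(x⁻) = lim_{t↑x} T(t)`. -/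
noncomputable def fm (T : ITM r) (x : ℝ) : ℝ :=
  if x ∈ Set.Ioc (0 : ℝ) 1 then x + T.gamma (T.idxm x) else x

/-- Dynamics on signed points: `(x, true)` represents `x⁺` and `(x, false)` represents `x⁻`. -/
noncomputable def sf (T : ITM r) (p : ℝ × Bool) : ℝ × Bool :=
  if p.2 then (T.f p.1, true) else (T.fm p.1, false)

/-- `X_n = T^n(I)`. -/
noncomputable def Xn (T : ITM r) (n : ℕ) : Set ℝ := (T.f)^[n] '' unitIco

/-- The attractor `X = ⋂_{n≥0} X_n`. -/
noncomputable def X (T : ITM r) : Set ℝ := ⋂ n : ℕ, T.Xn n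

/-- The closure `X̄` of the attractor in `[0,1]` (equivalently, in `ℝ`). -/
noncomputable def Xbar (T : ITM r) : Set ℝ := closure T.X

/-- `T` is of finite type if `X_{n+1} = X_n` for some `n`. -/
def FiniteType (T : ITM r) : Prop := ∃ n : ℕ, T.Xn (n + 1) = T.Xn n

/-- The set of (unsigned) discontinuities `{β₁, …, β_{r−1}}` of `T`. -/
def critSet (T : ITM r) : Set ℝ :=
  {b : ℝ | ∃ i : Fin (r + 1), i ≠ 0 ∧ i ≠ Fin.last r ∧ b = T.beta i}

/-- The signed critical set `𝒞 = {β₁⁻, β₁⁺, …, β_{r−1}⁻, β_{r−1}⁺}`. -/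
def signedCrit (T : ITM r) : Set (ℝ × Bool) := {p : ℝ × Bool | p.1 ∈ T.critSet}

/-- `x` lands on a discontinuity of `T`: some forward iterate (`k ≥ 0`) is a discontinuity. -/
def landsOnCrit (T : ITM r) (x : ℝ) : Prop := ∃ k : ℕ, (T.f)^[k] x ∈ T.critSet

/-- The first return time of `x` to the set `J` (by convention `0` if `x` never returns). -/
noncomputable def returnTime (T : ITM r) (J : Set ℝ) (x : ℝ) : ℕ :=
  sInf {k : ℕ | 0 < k ∧ (T.f)^[k] x ∈ J}

/-- The first return map `R_J`. -/
noncomputable def returnMap (T : ITM r) (J : Set ℝ) (x : ℝ) : ℝ :=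
  (T.f)^[T.returnTime J x] x

/-- `J` is an interval component of `X`: a connected component of `X` which is a
(nondegenerate, half-open) interval `[x,y)`. -/
def IsIntervalComponent (T : ITM r) (J : Set ℝ) : Prop :=
  (∃ z ∈ T.X, J = connectedComponentIn T.X z) ∧ ∃ x y : ℝ, x < y ∧ J = Set.Ico x y

/-- A dynamically trivial interval component: no point of its interior lands on a
discontinuity and the first return map is the identity. -/
def DynTrivial (T : ITM r) (J : Set ℝ) : Prop :=
  T.IsIntervalComponent J ∧ (∀ a ∈ interior J, ¬ T.landsOnCrit a) ∧
    ∀ z ∈ J, T.returnMap J z = z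

/-- Signed membership in `[x,y)`: `+`-points of `[x,y)` and `−`-points of `(x,y]`. -/
def smem (x y : ℝ) (p : ℝ × Bool) : Prop :=
  if p.2 then p.1 ∈ Set.Ico x y else p.1 ∈ Set.Ioc x y

/-- First return time of a signed point to the interval `[x,y)`. -/
noncomputable def sReturnTime (T : ITM r) (x y : ℝ) (p : ℝ × Bool) : ℕ :=
  sInf {k : ℕ | 0 < k ∧ smem x y ((T.sf)^[k] p)}

/-- Condition A1: for every interval component `J` of `X` and every `a ∈ J`, the orbit of
`a` up to (and not including) its return time to `J` contains at most one critical point. -/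
def A1 (T : ITM r) : Prop :=
  ∀ J : Set ℝ, T.IsIntervalComponent J → ∀ a ∈ J,
    Set.Subsingleton {c : ℝ | c ∈ T.critSet ∧ ∃ k < T.returnTime J a, (T.f)^[k] a = c}

/-- Condition A2: for every dynamically non-trivial interval component `[x,y)`, neither
(signed) boundary point `x⁺`, `y⁻` lands on a discontinuity up to (and not including)
its return time. -/
def A2 (T : ITM r) : Prop :=
  ∀ x y : ℝ, T.IsIntervalComponent (Set.Ico x y) → ¬ T.DynTrivial (Set.Ico x y) →
    (∀ k < T.sReturnTime x y (x, true), (T.sf)^[k] (x, true) ∉ T.signedCrit) ∧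
    (∀ k < T.sReturnTime x y (y, false), (T.sf)^[k] (y, false) ∉ T.signedCrit)

/-- `c'` is a ghost preimage of `c`: a signed discontinuity of opposite sign whose
(signed) orbit lands on the point of `c` with the sign of `c'`. -/
def GhostPre (T : ITM r) (c' c : ℝ × Bool) : Prop :=
  c ∈ T.signedCrit ∧ c' ∈ T.signedCrit ∧ c'.2 = !c.2 ∧
    ∃ k : ℕ, (T.sf)^[k] c' = (c.1, c'.2)

/-- A descending chain of length `n` in a ghost tree: `c (i+1)` is a ghost preimage of `c i`. -/
def GhostChain (T : ITM r) (n : ℕ) (c : ℕ → ℝ × Bool) : Prop :=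
  ∀ i < n, T.GhostPre (c (i + 1)) (c i)

/-- `b` occurs as a vertex of positive level in its own ghost tree `GT(b)`. -/
def SelfGhost (T : ITM r) (b : ℝ × Bool) : Prop :=
  ∃ n : ℕ, 0 < n ∧ ∃ c : ℕ → ℝ × Bool, c 0 = b ∧ c n = b ∧ T.GhostChain n c

/-- Condition A3: no discontinuity `β ∉ X` occurs in its own ghost tree at positive level. -/
def A3 (T : ITM r) : Prop := ∀ b ∈ T.signedCrit, b.1 ∉ T.X → ¬ T.SelfGhost b

/-- The Absence of Critical Connections condition. -/
def ACC (T : ITM r) : Prop := T.A1 ∧ T.A2 ∧ T.A3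

/-- The Matching condition: for every dynamically non-trivial interval component `J` of
`X`, exactly one point of the interior of `J` lands on a critical point before returning. -/
def Matching (T : ITM r) : Prop :=
  ∀ J : Set ℝ, T.IsIntervalComponent J → ¬ T.DynTrivial J →
    ∃! a : ℝ, a ∈ interior J ∧ ∃ k < T.returnTime J a, (T.f)^[k] a ∈ T.critSet

/-- Distance between two maps in the parameter space `ITM(r)`. -/
noncomputable def pdist (T S : ITM r) : ℝ := dist T.gamma S.gamma ⊔ dist T.beta S.beta

/-- The number of discontinuities of `T` contained in `I ∖ X̄`. -/
noncomputable def ncritOutside (T : ITM r) : ℕ := (T.critSet \ T.Xbar).ncard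

/-- `T` is stable: on some neighbourhood `𝒰` of `T` in `ITM(r)`, the assignment
`T̃ ↦ X̄(T̃)` is continuous in the Hausdorff topology, all `X̄(T̃)` are homeomorphic to
`X̄(T)`, and the number of discontinuities in `I ∖ X̄(T̃)` is constant. -/
def Stable (T : ITM r) : Prop :=
  ∃ δ : ℝ, 0 < δ ∧
    (∀ S : ITM r, pdist S T < δ → Nonempty (S.Xbar ≃ₜ T.Xbar)) ∧
    (∀ S : ITM r, pdist S T < δ → ∀ ε : ℝ, 0 < ε → ∃ η : ℝ, 0 < η ∧
      ∀ S' : ITM r, pdist S' T < δ → pdist S' S < η →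
        Metric.hausdorffDist S'.Xbar S.Xbar < ε) ∧
    (∀ S : ITM r, pdist S T < δ → S.ncritOutside = T.ncritOutside)

/-- The non-wandering set `Ω(T)` (neighbourhoods taken inside `I = [0,1)`). -/
def nonwandering (T : ITM r) : Set ℝ :=
  {x : ℝ | x ∈ unitIco ∧ ∀ U : Set ℝ, IsOpen U → x ∈ U →
    ∃ n : ℕ, 0 < n ∧ ((T.f)^[n] '' (U ∩ unitIco) ∩ (U ∩ unitIco)).Nonempty}

/-- `S` and `S'` are topologically conjugate on the sets `A`, `B`: there is a
homeomorphism `h : A → B` with `h ∘ S = S' ∘ h` on `A`. -/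
def TopConjOn (S S' : ITM r) (A B : Set ℝ) : Prop :=
  ∃ h g : ℝ → ℝ, Set.BijOn h A B ∧ ContinuousOn h A ∧ Set.InvOn g h A B ∧
    ContinuousOn g B ∧ ∀ x ∈ A, h (S.f x) = S'.f (h x)

/-- No point of the interior of `K` lands on a discontinuity before its return time to `J`. -/
def NoCritBeforeReturnOn (T : ITM r) (J K : Set ℝ) : Prop :=
  ∀ z ∈ interior K, ∀ k < T.returnTime J z, (T.f)^[k] z ∉ T.critSet

/-- `K` is a continuity interval of the first return map `R_J`: a maximal half-open
subinterval of `J` no interior point of which lands on a discontinuity before returning. -/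
def IsContinuityInterval (T : ITM r) (J K : Set ℝ) : Prop :=
  (∃ u v : ℝ, u < v ∧ K = Set.Ico u v) ∧ K ⊆ J ∧ T.NoCritBeforeReturnOn J K ∧
    ∀ K' : Set ℝ, (∃ u v : ℝ, u < v ∧ K' = Set.Ico u v) → K ⊆ K' → K' ⊆ J →
      T.NoCritBeforeReturnOn J K' → K' = K

/-- The itinerary symbol of a signed point. -/
noncomputable def sidx (T : ITM r) (p : ℝ × Bool) : Fin r :=
  if p.2 then T.idx p.1 else T.idxm p.1

/-- The forward orbit of `x` accumulates on `c` from the left. -/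
def accumFromLeft (T : ITM r) (x c : ℝ) : Prop :=
  ∃ n : ℕ → ℕ, StrictMono n ∧ StrictMono (fun k => (T.f)^[n k] x) ∧
    Filter.Tendsto (fun k => (T.f)^[n k] x) Filter.atTop (nhds c)

/-- The forward orbit of `x` accumulates on `c` from the right. -/
def accumFromRight (T : ITM r) (x c : ℝ) : Prop :=
  ∃ n : ℕ → ℕ, StrictMono n ∧ StrictAnti (fun k => (T.f)^[n k] x) ∧
    Filter.Tendsto (fun k => (T.f)^[n k] x) Filter.atTop (nhds c)

end ITM

namespace ITM

variable {r : ℕ}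

theorem beta_nonneg (T : ITM r) (i : Fin (r + 1)) : 0 ≤ T.beta i := by
  rw [← T.beta_zero]; exact T.beta_mono.monotone (Fin.zero_le i)

theorem beta_le_one (T : ITM r) (i : Fin (r + 1)) : T.beta i ≤ 1 := by
  rw [← T.beta_last]; exact T.beta_mono.monotone (Fin.le_last i)

theorem exists_mem_piece (T : ITM r) {x : ℝ} (hx : x ∈ unitIco) :
    ∃ i : Fin r, x ∈ Ico (T.beta i.castSucc) (T.beta i.succ) := by
  by_contra! h
  have key : ∀ i : Fin (r + 1), T.beta i ≤ x := by
    intro i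
    induction i using Fin.induction with
    | zero => rw [T.beta_zero]; exact hx.1
    | succ i ih =>
      by_contra! hlt
      exact h i ⟨ih, hlt⟩
  have := key (Fin.last r)
  rw [T.beta_last] at this
  exact absurd hx.2 (not_lt.2 this)

theorem piece_subset (T : ITM r) {x : ℝ} {i : Fin r}
    (hx : x ∈ Ico (T.beta i.castSucc) (T.beta i.succ)) : x ∈ unitIco :=
  ⟨(T.beta_nonneg _).trans hx.1, hx.2.trans_le (T.beta_le_one _)⟩

theorem piece_unique (T : ITM r) {x : ℝ} {i j : Fin r}
    (hi : x ∈ Ico (T.beta i.castSucc) (T.beta i.succ))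
    (hj : x ∈ Ico (T.beta j.castSucc) (T.beta j.succ)) : i = j := by
  by_contra hne
  rcases lt_or_gt_of_ne hne with h | h
  · have : T.beta i.succ ≤ T.beta j.castSucc := T.beta_mono.monotone (Fin.succ_le_castSucc_iff.2 h)
    linarith [hi.2, hj.1]
  · have : T.beta j.succ ≤ T.beta i.castSucc := T.beta_mono.monotone (Fin.succ_le_castSucc_iff.2 h)
    linarith [hj.2, hi.1]

theorem f_of_mem_piece (T : ITM r) {x : ℝ} {i : Fin r}
    (hx : x ∈ Ico (T.beta i.castSucc) (T.beta i.succ)) : T.f x = x + T.gamma i := by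
  have hidx : T.idx x = i := by
    have h : ∃ i : Fin r, x ∈ Ico (T.beta i.castSucc) (T.beta i.succ) := ⟨i, hx⟩
    rw [idx, dif_pos h]
    exact T.piece_unique h.choose_spec hx
  rw [f, if_pos (T.piece_subset hx), hidx]

theorem f_mem (T : ITM r) {x : ℝ} (hx : x ∈ unitIco) : T.f x ∈ unitIco := by
  obtain ⟨i, hi⟩ := T.exists_mem_piece hx
  rw [T.f_of_mem_piece hi]
  have := T.gamma_mem i
  exact ⟨by linarith [hi.1, this.1], by linarith [hi.2, this.2]⟩

theorem f_iterate_mem (T : ITM r) {x : ℝ} (hx : x ∈ unitIco) (n : ℕ) :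
    (T.f)^[n] x ∈ unitIco := by
  induction n with
  | zero => exact hx
  | succ n ih => rw [Function.iterate_succ_apply']; exact T.f_mem ih

theorem Xn_succ (T : ITM r) (n : ℕ) : T.Xn (n + 1) = T.f '' T.Xn n := by
  simp only [Xn, Function.iterate_succ', image_comp]

theorem Xn_subset (T : ITM r) (n : ℕ) : T.Xn n ⊆ unitIco := by
  rintro _ ⟨x, hx, rfl⟩; exact T.f_iterate_mem hx n

theorem Xn_succ_subset (T : ITM r) (n : ℕ) : T.Xn (n + 1) ⊆ T.Xn n := by
  rintro _ ⟨x, hx, rfl⟩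
  exact ⟨T.f x, T.f_mem hx, rfl⟩

theorem Xn_antitone (T : ITM r) : Antitone T.Xn :=
  antitone_nat_of_succ_le T.Xn_succ_subset

theorem X_subset (T : ITM r) : T.X ⊆ unitIco :=
  (iInter_subset _ 0).trans (T.Xn_subset 0)

theorem X_subset_Icc (T : ITM r) : T.X ⊆ Icc 0 1 :=
  T.X_subset.trans Ico_subset_Icc_self

theorem Xbar_subset (T : ITM r) : T.Xbar ⊆ Icc 0 1 :=
  closure_minimal T.X_subset_Icc isClosed_Icc

theorem f_mem_X (T : ITM r) {x : ℝ} (hx : x ∈ T.X) : T.f x ∈ T.X := by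
  refine mem_iInter.2 fun n => ?_
  apply T.Xn_succ_subset
  rw [Xn_succ]
  exact mem_image_of_mem _ (mem_iInter.1 hx n)

/-- Every point of the attractor has a preimage in the attractor. -/
theorem exists_preimage_mem_X (T : ITM r) {z : ℝ} (hz : z ∈ T.X) : ∃ w ∈ T.X, T.f w = z := by
  have h : ∀ n : ℕ, ∃ i : Fin r, z - T.gamma i ∈ T.Xn n ∧ T.f (z - T.gamma i) = z := by
    intro n
    have hn := mem_iInter.1 hz (n + 1)
    rw [Xn_succ] at hn
    obtain ⟨w, hw, rfl⟩ := hn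
    obtain ⟨i, hi⟩ := T.exists_mem_piece (T.Xn_subset n hw)
    refine ⟨i, ?_⟩
    have e : T.f w - T.gamma i = w := by rw [T.f_of_mem_piece hi]; ring
    rw [e]
    exact ⟨hw, rfl⟩
  choose i hi using h
  obtain ⟨j, hj⟩ := Finite.exists_infinite_fiber i
  have hinf : {n | i n = j}.Infinite := Set.infinite_coe_iff.1 hj
  refine ⟨z - T.gamma j, mem_iInter.2 fun n => ?_, ?_⟩
  · obtain ⟨m, hm, hnm⟩ := hinf.exists_gt n
    have := (hi m).1
    rw [hm] at this
    exact T.Xn_antitone hnm.le this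
  · obtain ⟨m, hm⟩ := hinf.nonempty
    have := (hi m).2
    rwa [hm] at this

/-- A set whose complement is open to the right at each of its points. -/
def RightClosed (A : Set ℝ) : Prop := ∀ z ∉ A, ∃ ε > 0, ∀ w ∈ Ico z (z + ε), w ∉ A

theorem rightClosed_Ico (a b : ℝ) : RightClosed (Ico a b) := by
  intro z hz
  by_cases h : z < a
  · exact ⟨a - z, by linarith, fun w hw hw' => by linarith [hw.2, hw'.1]⟩
  · have hb : b ≤ z := by
      by_contra! hb
      exact hz ⟨not_lt.1 h, hb⟩
    exact ⟨1, one_pos, fun w hw hw' => by linarith [hw.1, hw'.2]⟩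

theorem RightClosed.inter {A B : Set ℝ} (hA : RightClosed A) (hB : RightClosed B) :
    RightClosed (A ∩ B) := by
  intro z hz
  by_cases h : z ∈ A
  · obtain ⟨ε, hε, H⟩ := hB z fun hb => hz ⟨h, hb⟩
    exact ⟨ε, hε, fun w hw hw' => H w hw hw'.2⟩
  · obtain ⟨ε, hε, H⟩ := hA z h
    exact ⟨ε, hε, fun w hw hw' => H w hw hw'.1⟩

theorem RightClosed.iUnion {ι : Type*} [Finite ι] {A : ι → Set ℝ}
    (hA : ∀ i, RightClosed (A i)) : RightClosed (⋃ i, A i) := by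
  intro z hz
  have hz' : ∀ i, z ∉ A i := fun i hi => hz (mem_iUnion.2 ⟨i, hi⟩)
  choose ε hε H using fun i => hA i z (hz' i)
  rcases isEmpty_or_nonempty ι with h | h
  · exact ⟨1, one_pos, fun w _ hw => by simp at hw⟩
  · obtain ⟨i₀, hi₀⟩ := Finite.exists_min ε
    refine ⟨ε i₀, hε i₀, fun w hw hw' => ?_⟩
    obtain ⟨i, hi⟩ := mem_iUnion.1 hw'
    exact H i w ⟨hw.1, hw.2.trans_le (by linarith [hi₀ i])⟩ hi

theorem RightClosed.image_add {A : Set ℝ} (hA : RightClosed A) (c : ℝ) :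
    RightClosed ((fun x => x + c) '' A) := by
  intro z hz
  obtain ⟨ε, hε, H⟩ := hA (z - c) fun h => hz ⟨z - c, h, by simp⟩
  refine ⟨ε, hε, ?_⟩
  rintro w hw ⟨v, hv, rfl⟩
  exact H v ⟨by linarith [hw.1], by linarith [hw.2]⟩ hv

theorem image_f_eq_iUnion (T : ITM r) {A : Set ℝ} (hA : A ⊆ unitIco) :
    T.f '' A = ⋃ i : Fin r, (fun x => x + T.gamma i) ''
      (A ∩ Ico (T.beta i.castSucc) (T.beta i.succ)) := by
  ext z
  constructor
  · rintro ⟨x, hx, rfl⟩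
    obtain ⟨i, hi⟩ := T.exists_mem_piece (hA hx)
    exact mem_iUnion.2 ⟨i, x, ⟨hx, hi⟩, (T.f_of_mem_piece hi).symm⟩
  · intro hz
    obtain ⟨i, x, ⟨hx, hi⟩, rfl⟩ := mem_iUnion.1 hz
    exact ⟨x, hx, T.f_of_mem_piece hi⟩

theorem RightClosed.image_f (T : ITM r) {A : Set ℝ} (hA : A ⊆ unitIco) (h : RightClosed A) :
    RightClosed (T.f '' A) := by
  rw [T.image_f_eq_iUnion hA]
  exact RightClosed.iUnion fun i => (h.inter (rightClosed_Ico _ _)).image_add _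

theorem rightClosed_Xn (T : ITM r) (n : ℕ) : RightClosed (T.Xn n) := by
  induction n with
  | zero => simpa [Xn, unitIco] using rightClosed_Ico 0 1
  | succ n ih => rw [Xn_succ]; exact ih.image_f T (T.Xn_subset n)

theorem volume_image_f_le (T : ITM r) {A : Set ℝ} (hA : A ⊆ unitIco) (hm : MeasurableSet A) :
    MeasureTheory.volume (T.f '' A) ≤ MeasureTheory.volume A := by
  rw [T.image_f_eq_iUnion hA]
  calc MeasureTheory.volume (⋃ i : Fin r, (fun x => x + T.gamma i) ''
        (A ∩ Ico (T.beta i.castSucc) (T.beta i.succ)))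
      ≤ ∑ i : Fin r, MeasureTheory.volume ((fun x => x + T.gamma i) ''
        (A ∩ Ico (T.beta i.castSucc) (T.beta i.succ))) :=
        MeasureTheory.measure_iUnion_fintype_le _ _
    _ = ∑ i : Fin r, MeasureTheory.volume (A ∩ Ico (T.beta i.castSucc) (T.beta i.succ)) := by
        refine Finset.sum_congr rfl fun i _ => ?_
        rw [image_add_right, MeasureTheory.measure_preimage_add_right]
    _ = MeasureTheory.volume (⋃ i : Fin r, A ∩ Ico (T.beta i.castSucc) (T.beta i.succ)) := by
        rw [MeasureTheory.measure_iUnion, tsum_fintype]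
        · intro i j hij
          refine Set.disjoint_left.2 fun x hx hx' => hij (T.piece_unique hx.2 hx'.2)
        · exact fun i => hm.inter measurableSet_Ico
    _ ≤ MeasureTheory.volume A := MeasureTheory.measure_mono (iUnion_subset fun i => inter_subset_left)

end ITM

namespace ITM

variable {r : ℕ}

/-- The closure of the attractor is the disjoint union of the closed intervals listed in `F`. -/
structure IsDecomp (T : ITM r) (F : Finset (ℝ × ℝ)) : Prop where
  lt : ∀ p ∈ F, p.1 < p.2
  disj : ∀ p ∈ F, ∀ q ∈ F, p ≠ q → Disjoint (Icc p.1 p.2) (Icc q.1 q.2)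
  eq : T.Xbar = ⋃ p ∈ F, Icc p.1 p.2

/-- The union of the half-open intervals listed in `F`. -/
def core (F : Finset (ℝ × ℝ)) : Set ℝ := ⋃ p ∈ F, Ico p.1 p.2

theorem mem_core {F : Finset (ℝ × ℝ)} {z : ℝ} : z ∈ core F ↔ ∃ p ∈ F, z ∈ Ico p.1 p.2 := by
  simp only [core, mem_iUnion, exists_prop]

theorem measurableSet_core (F : Finset (ℝ × ℝ)) : MeasurableSet (core F) :=
  F.measurableSet_biUnion fun _ _ => measurableSet_Ico

theorem exists_Ico_subset_core {F : Finset (ℝ × ℝ)} {z : ℝ} (hz : z ∈ core F) :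
    ∃ ε > 0, Ico z (z + ε) ⊆ core F := by
  obtain ⟨p, hp, h⟩ := mem_core.1 hz
  exact ⟨p.2 - z, by linarith [h.2], fun w hw => mem_core.2
    ⟨p, hp, h.1.trans hw.1, by linarith [hw.2]⟩⟩

namespace IsDecomp

variable {T : ITM r} {F : Finset (ℝ × ℝ)}

theorem mem_Xbar (h : T.IsDecomp F) {z : ℝ} : z ∈ T.Xbar ↔ ∃ p ∈ F, z ∈ Icc p.1 p.2 := by
  rw [h.eq]; simp only [mem_iUnion, exists_prop]

theorem eq_of_mem (h : T.IsDecomp F) {p q : ℝ × ℝ} (hp : p ∈ F) (hq : q ∈ F) {z : ℝ}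
    (hzp : z ∈ Icc p.1 p.2) (hzq : z ∈ Icc q.1 q.2) : p = q := by
  by_contra hne
  exact Set.disjoint_left.1 (h.disj p hp q hq hne) hzp hzq

theorem core_subset_X (h : T.IsDecomp F) : core F ⊆ T.X := by
  intro z hz
  refine mem_iInter.2 fun n => ?_
  by_contra hn
  obtain ⟨ε, hε, H⟩ := T.rightClosed_Xn n z hn
  obtain ⟨δ, hδ, hsub⟩ := exists_Ico_subset_core hz
  set m := min ε δ
  have hm : 0 < m := lt_min hε hδ
  have hc : z + m / 2 ∈ T.Xbar := by
    obtain ⟨p, hp, hpz⟩ := mem_core.1 (hsub (show z + m / 2 ∈ Ico z (z + δ) from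
      ⟨by linarith, by linarith [min_le_right ε δ]⟩))
    exact h.mem_Xbar.2 ⟨p, hp, Ico_subset_Icc_self hpz⟩
  obtain ⟨w, hw, hwX⟩ := mem_closure_iff.1 hc (Ioo z (z + m)) isOpen_Ioo
    ⟨by linarith, by linarith⟩
  exact H w ⟨hw.1.le, hw.2.trans_le (by linarith [min_le_left ε δ])⟩ (mem_iInter.1 hwX n)

theorem core_subset_unitIco (h : T.IsDecomp F) : core F ⊆ unitIco :=
  h.core_subset_X.trans T.X_subset

/-- Just to the right of a point outside the core there are only points outside `X̄`. -/
theorem exists_gap (h : T.IsDecomp F) {z : ℝ} (hz : z ∉ core F) :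
    ∃ ε > 0, ∀ w ∈ Ioo z (z + ε), w ∉ T.Xbar := by
  have key : ∀ p : F, ∃ ε > 0, ∀ w ∈ Ioo z (z + ε), w ∉ Icc p.1.1 p.1.2 := by
    rintro ⟨p, hp⟩
    by_cases hlt : z < p.1
    · exact ⟨p.1 - z, by linarith, fun w hw hw' => by linarith [hw.2, hw'.1]⟩
    · have hb : p.2 ≤ z := by
        by_contra! hb
        exact hz (mem_core.2 ⟨p, hp, not_lt.1 hlt, hb⟩)
      exact ⟨1, one_pos, fun w hw hw' => by linarith [hw.1, hw'.2]⟩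
  choose ε hε H using key
  rcases isEmpty_or_nonempty F with hF | hF
  · refine ⟨1, one_pos, fun w _ hw => ?_⟩
    obtain ⟨p, hp, _⟩ := h.mem_Xbar.1 hw
    exact hF.elim ⟨p, hp⟩
  · obtain ⟨p₀, hp₀⟩ := Finite.exists_min ε
    refine ⟨ε p₀, hε p₀, fun w hw hw' => ?_⟩
    obtain ⟨p, hp, hpw⟩ := h.mem_Xbar.1 hw'
    exact H ⟨p, hp⟩ w ⟨hw.1, hw.2.trans_le (by linarith [hp₀ ⟨p, hp⟩])⟩ hpw

/-- A point of the core has a right neighbourhood in the core on which `T` is a translation. -/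
theorem exists_translation (h : T.IsDecomp F) {z : ℝ} (hz : z ∈ core F) :
    ∃ ε > 0, ∀ s ∈ Ico 0 ε, z + s ∈ core F ∧ T.f (z + s) = T.f z + s := by
  obtain ⟨ε, hε, hsub⟩ := exists_Ico_subset_core hz
  obtain ⟨i, hi⟩ := T.exists_mem_piece (h.core_subset_unitIco hz)
  refine ⟨min ε (T.beta i.succ - z), lt_min hε (by linarith [hi.2]), fun s hs => ⟨?_, ?_⟩⟩
  · exact hsub ⟨by linarith [hs.1], by linarith [hs.2, min_le_left ε (T.beta i.succ - z)]⟩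
  · rw [T.f_of_mem_piece hi, T.f_of_mem_piece (i := i) ⟨by linarith [hs.1, hi.1],
      by linarith [hs.2, min_le_right ε (T.beta i.succ - z)]⟩]
    ring

theorem f_mem_core (h : T.IsDecomp F) {z : ℝ} (hz : z ∈ core F) : T.f z ∈ core F := by
  by_contra hn
  obtain ⟨ε, hε, H⟩ := h.exists_gap hn
  obtain ⟨δ, hδ, H'⟩ := h.exists_translation hz
  set m := min ε δ
  have hm : 0 < m := lt_min hε hδ
  obtain ⟨h1, h2⟩ := H' (m / 2) ⟨by linarith, by linarith [min_le_right ε δ]⟩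
  refine H (T.f z + m / 2) ⟨by linarith, by linarith [min_le_left ε δ]⟩ ?_
  rw [← h2]
  exact subset_closure (T.f_mem_X (h.core_subset_X h1))

theorem iterate_mem_core (h : T.IsDecomp F) {z : ℝ} (hz : z ∈ core F) (n : ℕ) :
    (T.f)^[n] z ∈ core F := by
  induction n with
  | zero => exact hz
  | succ n ih => rw [Function.iterate_succ_apply']; exact h.f_mem_core ih

theorem rightClosed_core (F : Finset (ℝ × ℝ)) : RightClosed (core F) := by
  have : core F = ⋃ p : F, Ico p.1.1 p.1.2 := by
    ext z; simp [core]
  rw [this]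
  exact RightClosed.iUnion fun p => rightClosed_Ico _ _

theorem X_diff_core_finite (h : T.IsDecomp F) : (T.X \ core F).Finite := by
  refine (F.image Prod.snd).finite_toSet.subset fun z hz => ?_
  obtain ⟨p, hp, hpz⟩ := h.mem_Xbar.1 (subset_closure hz.1)
  have : z = p.2 := by
    by_contra hne
    exact hz.2 (mem_core.2 ⟨p, hp, hpz.1, lt_of_le_of_ne hpz.2 hne⟩)
  simp only [Finset.coe_image, mem_image]
  exact ⟨p, hp, this.symm⟩

theorem surjOn_core (h : T.IsDecomp F) {z : ℝ} (hz : z ∈ core F) : ∃ w ∈ core F, T.f w = z := by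
  by_contra! hn
  have hz' : z ∉ T.f '' core F := by
    rintro ⟨w, hw, rfl⟩; exact hn w hw rfl
  obtain ⟨ε, hε, H⟩ := (rightClosed_core F).image_f T h.core_subset_unitIco z hz'
  obtain ⟨δ, hδ, hsub⟩ := exists_Ico_subset_core hz
  have hfin : (T.f '' (T.X \ core F)).Finite := h.X_diff_core_finite.image _
  have hinf : (Ico z (z + min ε δ)).Infinite :=
    Ico_infinite (by linarith [lt_min hε hδ])
  refine hinf (hfin.subset fun t ht => ?_)
  obtain ⟨w, hw, rfl⟩ := T.exists_preimage_mem_X (h.core_subset_X (hsub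
    ⟨ht.1, ht.2.trans_le (by linarith [min_le_right ε δ])⟩))
  refine ⟨w, ⟨hw, fun hwc => ?_⟩, rfl⟩
  exact H _ ⟨ht.1, ht.2.trans_le (by linarith [min_le_left ε δ])⟩ ⟨w, hwc, rfl⟩

theorem injOn_core (h : T.IsDecomp F) : InjOn T.f (core F) := by
  intro w hw v hv hwv
  by_contra hne
  wlog hlt : w < v generalizing w v
  · exact this hv hw hwv.symm (Ne.symm hne) (lt_of_le_of_ne (not_lt.1 hlt) (Ne.symm hne))
  obtain ⟨ε, hε, H⟩ := h.exists_translation hw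
  obtain ⟨δ, hδ, H'⟩ := h.exists_translation hv
  set m := min (min ε δ) (v - w)
  have hm : 0 < m := lt_min (lt_min hε hδ) (by linarith)
  have hmε : m ≤ ε := (min_le_left _ _).trans (min_le_left _ _)
  have hmδ : m ≤ δ := (min_le_left _ _).trans (min_le_right _ _)
  have hmd : m ≤ v - w := min_le_right _ _
  have hI : Ico w (w + m) ⊆ core F := fun t ht => by
    have := (H (t - w) ⟨by linarith [ht.1], by linarith [ht.2]⟩).1
    simpa using this
  have hcov : core F ⊆ T.f '' (core F \ Ico w (w + m)) := by
    intro z hz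
    obtain ⟨t, ht, rfl⟩ := h.surjOn_core hz
    by_cases hti : t ∈ Ico w (w + m)
    · have h1 := (H (t - w) ⟨by linarith [hti.1], by linarith [hti.2]⟩).2
      obtain ⟨h2, h3⟩ := H' (t - w) ⟨by linarith [hti.1], by linarith [hti.2]⟩
      refine ⟨v + (t - w), ⟨h2, fun hbad => by linarith [hbad.2, hti.1]⟩, ?_⟩
      rw [h3, ← hwv, ← h1]
      congr 1; ring
    · exact ⟨t, ⟨ht, hti⟩, rfl⟩
  have hfin : MeasureTheory.volume (core F) ≠ ⊤ := by
    refine ne_top_of_le_ne_top ?_ (MeasureTheory.measure_mono h.core_subset_unitIco)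
    simp [unitIco]
  have h1 := (MeasureTheory.measure_mono (μ := MeasureTheory.volume) hcov).trans
    (T.volume_image_f_le (sdiff_subset.trans h.core_subset_unitIco)
      ((measurableSet_core F).diff measurableSet_Ico))
  have h2 := MeasureTheory.measure_sdiff_add_inter (μ := MeasureTheory.volume) (core F)
    (measurableSet_Ico : MeasurableSet (Ico w (w + m)))
  rw [inter_eq_self_of_subset_right hI, Real.volume_Ico] at h2
  rw [← h2] at h1 hfin
  have h3 : MeasureTheory.volume (core F \ Ico w (w + m)) ≠ ⊤ := fun h0 => hfin (by simp [h0])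
  have h4 : 0 < ENNReal.ofReal (w + m - w) := by simpa using hm
  exact absurd h1 (not_le.2 (ENNReal.lt_add_right h3 h4.ne'))

theorem iterate_injOn_core (h : T.IsDecomp F) (n : ℕ) : InjOn ((T.f)^[n]) (core F) :=
  h.injOn_core.iterate (fun _ hz => h.f_mem_core hz) n

end IsDecomp

end ITM

namespace ITM

variable {r : ℕ}

theorem linearIndependent_step :
    LinearIndependent ℝ (fun w z : ℝ => if w ≤ z then (1 : ℝ) else 0) := by
  rw [linearIndependent_iff']
  intro s g hg
  by_contra! hne
  obtain ⟨i, his, hi⟩ := hne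
  obtain ⟨w, hw, hmin⟩ := (s.filter fun w => g w ≠ 0).exists_min_image id
    ⟨i, Finset.mem_filter.2 ⟨his, hi⟩⟩
  rw [Finset.mem_filter] at hw
  have h0 := congrFun hg w
  rw [Finset.sum_apply, Finset.sum_eq_single w] at h0
  · simp at h0
    exact hw.2 h0
  · intro v hv hvw
    by_cases hgv : g v = 0
    · simp [hgv]
    · have := hmin v (Finset.mem_filter.2 ⟨hv, hgv⟩)
      have hlt : ¬ v ≤ w := not_le.2 (lt_of_le_of_ne this (Ne.symm hvw))
      simp [hlt]
  · exact fun h => absurd hw.1 h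

/-- The total increment of `h` over the part of the core to the left of `z`. -/
def tailSum (F : Finset (ℝ × ℝ)) (h : ℝ → ℝ) (z : ℝ) : ℝ :=
  ∑ p ∈ F, (h (min p.2 z) - h (min p.1 z))

/-- The boundary divisor of the part of the core to the left of `z`, translated by `c`. -/
noncomputable def tailDivisor (F : Finset (ℝ × ℝ)) (c z : ℝ) : ℝ →₀ ℝ :=
  ∑ p ∈ F, (Finsupp.single (min p.2 z + c) 1 - Finsupp.single (min p.1 z + c) 1)

theorem linearCombination_tailDivisor (F : Finset (ℝ × ℝ)) (h : ℝ → ℝ) (c z : ℝ) :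
    Finsupp.linearCombination ℝ h (tailDivisor F c z) = tailSum F (fun t => h (t + c)) z := by
  simp [tailDivisor, tailSum, map_sum]

/-- The partition interval of index `i`, cut at `z - γ i`: its right endpoint. -/
noncomputable def cut (T : ITM r) (z : ℝ) (i : Fin r) : ℝ :=
  max (T.beta i.castSucc) (min (T.beta i.succ) (z - T.gamma i))

theorem cut_eq_of_mem (T : ITM r) {z : ℝ} {i : Fin r}
    (h : z - T.gamma i ∈ Ico (T.beta i.castSucc) (T.beta i.succ)) :
    T.cut z i = z - T.gamma i := by
  rw [cut, min_eq_right h.2.le, max_eq_right h.1]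

theorem cut_eq_or (T : ITM r) (z : ℝ) (i : Fin r) :
    T.cut z i = T.beta i.castSucc ∨ T.cut z i = T.beta i.succ ∨
      T.cut z i = z - T.gamma i ∧
        z - T.gamma i ∈ Ico (T.beta i.castSucc) (T.beta i.succ) := by
  have hlt : T.beta i.castSucc < T.beta i.succ := T.beta_mono Fin.castSucc_lt_succ
  rcases lt_or_ge (z - T.gamma i) (T.beta i.castSucc) with h | h
  · left
    rw [cut, min_eq_right (h.trans hlt).le, max_eq_left h.le]
  · rcases lt_or_ge (z - T.gamma i) (T.beta i.succ) with h' | h'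
    · exact Or.inr (Or.inr ⟨T.cut_eq_of_mem ⟨h, h'⟩, h, h'⟩)
    · right; left
      rw [cut, min_eq_left h', max_eq_right hlt.le]

namespace IsDecomp

variable {T : ITM r} {F : Finset (ℝ × ℝ)}

theorem linearCombination_step_tailDivisor (h : T.IsDecomp F) (c z t : ℝ) :
    Finsupp.linearCombination ℝ (fun w z : ℝ => if w ≤ z then (1 : ℝ) else 0)
      (tailDivisor F c z) t = - if t - c ∈ core F ∧ t - c < z then 1 else 0 := by
  have hterm : ∀ p ∈ F, ((if min p.2 z + c ≤ t then (1 : ℝ) else 0) -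
      if min p.1 z + c ≤ t then 1 else 0) =
      - if t - c ∈ Ico p.1 p.2 ∧ t - c < z then 1 else 0 := by
    intro p hp
    have hlt := h.lt p hp
    simp only [← le_sub_iff_add_le, min_le_iff, mem_Ico]
    generalize t - c = s
    split_ifs <;> grind
  have h1 : Finsupp.linearCombination ℝ (fun w z : ℝ => if w ≤ z then (1 : ℝ) else 0)
      (tailDivisor F c z) t = ∑ p ∈ F, ((if min p.2 z + c ≤ t then (1 : ℝ) else 0) -
      if min p.1 z + c ≤ t then 1 else 0) := by
    simp [tailDivisor, map_sum, Finset.sum_apply]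
  rw [h1, Finset.sum_congr rfl hterm, Finset.sum_neg_distrib]
  congr 1
  by_cases hc : t - c ∈ core F
  · obtain ⟨p, hp, hpt⟩ := mem_core.1 hc
    rw [Finset.sum_eq_single_of_mem p hp]
    · simp [hc, hpt.1, hpt.2]
    · intro q hq hqp
      rw [if_neg]
      rintro ⟨hqt, -⟩
      exact hqp (h.eq_of_mem hq hp (Ico_subset_Icc_self hqt) (Ico_subset_Icc_self hpt))
  · rw [if_neg fun h' => hc h'.1]
    refine Finset.sum_eq_zero fun p hp => if_neg fun h' => hc (mem_core.2 ⟨p, hp, h'.1⟩)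

theorem tailDivisor_eq_sum (h : T.IsDecomp F) (z : ℝ) :
    tailDivisor F 0 z = ∑ i : Fin r, (tailDivisor F (T.gamma i) (T.cut z i) -
      tailDivisor F (T.gamma i) (T.beta i.castSucc)) := by
  apply linearIndependent_step
  funext t
  simp only [map_sum, map_sub, Finset.sum_apply, Pi.sub_apply,
    h.linearCombination_step_tailDivisor, sub_zero]
  have hterm : ∀ i : Fin r,
      (-(if t - T.gamma i ∈ core F ∧ t - T.gamma i < T.cut z i then (1 : ℝ) else 0) -
        -if t - T.gamma i ∈ core F ∧ t - T.gamma i < T.beta i.castSucc then 1 else 0) =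
      - if t - T.gamma i ∈ core F ∧ t - T.gamma i ∈ Ico (T.beta i.castSucc) (T.beta i.succ) ∧
        t < z then 1 else 0 := by
    intro i
    have hlt : T.beta i.castSucc < T.beta i.succ := T.beta_mono Fin.castSucc_lt_succ
    have hz : t < z ↔ t - T.gamma i < z - T.gamma i := by simp
    simp only [cut, hz, mem_Ico, lt_max_iff, lt_min_iff]
    split_ifs <;> grind
  rw [Finset.sum_congr rfl fun i _ => hterm i, Finset.sum_neg_distrib]
  congr 1
  by_cases hc : t ∈ core F ∧ t < z
  · obtain ⟨w, hw, hwt⟩ := h.surjOn_core hc.1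
    obtain ⟨j, hj⟩ := T.exists_mem_piece (h.core_subset_unitIco hw)
    have hwj : t - T.gamma j = w := by rw [← hwt, T.f_of_mem_piece hj]; ring
    rw [if_pos hc, Finset.sum_eq_single_of_mem j (Finset.mem_univ j)]
    · rw [hwj, if_pos ⟨hw, hj, hc.2⟩]
    · intro i _ hij
      rw [if_neg]
      rintro ⟨h1, h2, -⟩
      have hfi : T.f (t - T.gamma i) = t := by rw [T.f_of_mem_piece h2]; ring
      have := h.injOn_core h1 hw (hfi.trans hwt.symm)
      rw [this] at h2
      exact hij (T.piece_unique h2 hj)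
  · rw [if_neg hc, eq_comm]
    refine Finset.sum_eq_zero fun i _ => if_neg ?_
    rintro ⟨h1, h2, h3⟩
    have hfi : T.f (t - T.gamma i) = t := by rw [T.f_of_mem_piece h2]; ring
    exact hc ⟨hfi ▸ h.f_mem_core h1, h3⟩

theorem tailSum_eq_sum (h : T.IsDecomp F) (g : ℝ → ℝ) (z : ℝ) :
    tailSum F g z = ∑ i : Fin r, (tailSum F (fun t => g (t + T.gamma i)) (T.cut z i) -
      tailSum F (fun t => g (t + T.gamma i)) (T.beta i.castSucc)) := by
  have := congrArg (Finsupp.linearCombination ℝ g) (h.tailDivisor_eq_sum z)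
  simpa only [map_sum, map_sub, linearCombination_tailDivisor, add_zero] using this

theorem fst_mem_core (h : T.IsDecomp F) {p : ℝ × ℝ} (hp : p ∈ F) : p.1 ∈ core F :=
  mem_core.2 ⟨p, hp, le_rfl, h.lt p hp⟩

theorem snd_le_one (h : T.IsDecomp F) {p : ℝ × ℝ} (hp : p ∈ F) : p.2 ≤ 1 :=
  (T.Xbar_subset (h.mem_Xbar.2 ⟨p, hp, (h.lt p hp).le, le_rfl⟩)).2

theorem tailSum_zero (h : T.IsDecomp F) (g : ℝ → ℝ) : tailSum F g 0 = 0 := by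
  refine Finset.sum_eq_zero fun p hp => ?_
  have h1 := (h.core_subset_unitIco (h.fst_mem_core hp)).1
  rw [min_eq_right h1, min_eq_right (h1.trans (h.lt p hp).le), sub_self]

theorem tailSum_of_one_le (h : T.IsDecomp F) (g : ℝ → ℝ) {z : ℝ} (hz : 1 ≤ z) :
    tailSum F g z = tailSum F g 1 := by
  refine Finset.sum_congr rfl fun p hp => ?_
  have h2 := h.snd_le_one hp
  have h1 := (h.lt p hp).le.trans h2
  rw [min_eq_left h1, min_eq_left h2, min_eq_left (h1.trans hz), min_eq_left (h2.trans hz)]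

theorem sum_succ_sub_castSucc (g : Fin (r + 1) → ℝ) :
    ∑ i : Fin r, (g i.succ - g i.castSucc) = g (Fin.last r) - g 0 := by
  have h1 := Fin.sum_univ_succ g
  have h2 := Fin.sum_univ_castSucc g
  rw [Finset.sum_sub_distrib]
  linarith

variable {φ : ℝ →+ ℝ}

/-- If `φ` is additive and vanishes on the translation lengths, and these can be separated by
additive functionals, then the `φ`-measure of the core in each partition interval is zero. -/
theorem tailSum_beta (h : T.IsDecomp F) (hφ : ∀ i, φ (T.gamma i) = 0)
    (hψ : ∀ i, ∃ ψ : ℝ →+ ℝ, ∀ j, ψ (T.gamma j) = if j = i then 1 else 0) (i : Fin (r + 1)) :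
    tailSum F φ (T.beta i) = 0 := by
  have hstep : ∀ i : Fin r, tailSum F φ (T.beta i.succ) = tailSum F φ (T.beta i.castSucc) := by
    intro i
    obtain ⟨ψ, hψ⟩ := hψ i
    have hshift : ∀ (j : Fin r) (z : ℝ),
        tailSum F (fun t => φ (t + T.gamma j) * ψ (t + T.gamma j)) z =
          tailSum F (fun t => φ t * ψ t) z + (if j = i then 1 else 0) * tailSum F φ z := by
      intro j z
      simp only [tailSum, Finset.mul_sum, ← Finset.sum_add_distrib]
      refine Finset.sum_congr rfl fun p _ => ?_
      simp only [map_add, hφ, hψ]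
      ring
    have hcut : ∀ j : Fin r, T.cut 2 j = T.beta j.succ := by
      intro j
      have hlt : T.beta j.castSucc < T.beta j.succ := T.beta_mono Fin.castSucc_lt_succ
      have h1 := (T.gamma_mem j).2
      rw [cut, min_eq_left (by linarith), max_eq_right hlt.le]
    have h1 := h.tailSum_eq_sum (fun t => φ t * ψ t) 2
    simp only [hshift, hcut] at h1
    have h2 := sum_succ_sub_castSucc fun k => tailSum F (fun t => φ t * ψ t) (T.beta k)
    have h3 : ∑ j : Fin r, ((if j = i then (1 : ℝ) else 0) * tailSum F φ (T.beta j.succ) -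
        (if j = i then (1 : ℝ) else 0) * tailSum F φ (T.beta j.castSucc)) =
        tailSum F φ (T.beta i.succ) - tailSum F φ (T.beta i.castSucc) := by
      simp [Finset.sum_sub_distrib]
    rw [h.tailSum_of_one_le _ one_le_two] at h1
    rw [T.beta_last, T.beta_zero, h.tailSum_zero, ] at h2
    simp only [add_sub_add_comm, Finset.sum_add_distrib] at h1
    rw [h2, h3] at h1
    linarith
  induction i using Fin.induction with
  | zero => rw [T.beta_zero, h.tailSum_zero]
  | succ i ih => rw [hstep, ih]

theorem tailSum_eq_sum_cut (h : T.IsDecomp F) (hφ : ∀ i, φ (T.gamma i) = 0)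
    (hψ : ∀ i, ∃ ψ : ℝ →+ ℝ, ∀ j, ψ (T.gamma j) = if j = i then 1 else 0) (z : ℝ) :
    tailSum F φ z = ∑ i : Fin r, tailSum F φ (T.cut z i) := by
  have h1 := h.tailSum_eq_sum φ z
  have h2 : ∀ i : Fin r, (fun t => φ (t + T.gamma i)) = φ := fun i => by
    funext t; rw [map_add, hφ, add_zero]
  simpa only [h2, h.tailSum_beta hφ hψ, sub_zero] using h1

theorem mem_piece_of_tailSum_cut_ne_zero (h : T.IsDecomp F) (hφ : ∀ i, φ (T.gamma i) = 0)
    (hψ : ∀ i, ∃ ψ : ℝ →+ ℝ, ∀ j, ψ (T.gamma j) = if j = i then 1 else 0) {z : ℝ} {i : Fin r}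
    (hne : tailSum F φ (T.cut z i) ≠ 0) : T.cut z i = z - T.gamma i ∧
      z - T.gamma i ∈ Ico (T.beta i.castSucc) (T.beta i.succ) := by
  rcases T.cut_eq_or z i with hc | hc | hc
  · exact absurd (by rw [hc, h.tailSum_beta hφ hψ]) hne
  · exact absurd (by rw [hc, h.tailSum_beta hφ hψ]) hne
  · exact hc

theorem mem_Xn_of_tailSum_ne_zero (h : T.IsDecomp F) (hφ : ∀ i, φ (T.gamma i) = 0)
    (hψ : ∀ i, ∃ ψ : ℝ →+ ℝ, ∀ j, ψ (T.gamma j) = if j = i then 1 else 0) (n : ℕ) :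
    ∀ z ∉ core F, tailSum F φ z ≠ 0 → z ∈ T.Xn n := by
  have back : ∀ z ∉ core F, tailSum F φ z ≠ 0 →
      ∃ w ∈ unitIco, w ∉ core F ∧ tailSum F φ w ≠ 0 ∧ T.f w = z := by
    intro z hz hne
    rw [h.tailSum_eq_sum_cut hφ hψ] at hne
    obtain ⟨i, -, hi⟩ := Finset.exists_ne_zero_of_sum_ne_zero hne
    obtain ⟨h1, h2⟩ := h.mem_piece_of_tailSum_cut_ne_zero hφ hψ hi
    have hf : T.f (z - T.gamma i) = z := by rw [T.f_of_mem_piece h2]; ring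
    exact ⟨z - T.gamma i, T.piece_subset h2, fun hw => hz (hf ▸ h.f_mem_core hw), h1 ▸ hi, hf⟩
  induction n with
  | zero =>
    intro z hz hne
    obtain ⟨w, hw, -, -, rfl⟩ := back z hz hne
    exact ⟨T.f w, T.f_mem hw, rfl⟩
  | succ n ih =>
    intro z hz hne
    obtain ⟨w, -, hwc, hwn, rfl⟩ := back z hz hne
    rw [Xn_succ]
    exact ⟨w, ih w hwc hwn, rfl⟩

theorem tailSum_of_notMem_core (h : T.IsDecomp F) (hφ : ∀ i, φ (T.gamma i) = 0)
    (hψ : ∀ i, ∃ ψ : ℝ →+ ℝ, ∀ j, ψ (T.gamma j) = if j = i then 1 else 0) {z : ℝ}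
    (hz : z ∉ core F) : tailSum F φ z = 0 := by
  obtain ⟨ε, hε, H⟩ := h.exists_gap hz
  have hgap : ∀ p ∈ F, p.2 ≤ z ∨ z + ε ≤ p.1 := by
    intro p hp
    have hlt := h.lt p hp
    by_contra! hcon
    have h1 : p.1 ≤ z := by
      by_contra! hlt'
      exact H p.1 ⟨hlt', hcon.2⟩ (subset_closure (h.core_subset_X (h.fst_mem_core hp)))
    exact hz (mem_core.2 ⟨p, hp, h1, hcon.1⟩)
  have heq : tailSum F φ z = tailSum F φ (z + ε / 2) := by
    refine Finset.sum_congr rfl fun p hp => ?_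
    have hlt := h.lt p hp
    rcases hgap p hp with hp' | hp'
    · rw [min_eq_left hp', min_eq_left (by linarith), min_eq_left (by linarith),
        min_eq_left (by linarith)]
    · rw [min_eq_right (by linarith), min_eq_right (by linarith), min_eq_right (by linarith),
        min_eq_right (by linarith), sub_self, sub_self]
  rw [heq]
  have hX : z + ε / 2 ∉ T.X := fun hX =>
    H _ ⟨by linarith, by linarith⟩ (subset_closure hX)
  by_contra hne
  exact hX (mem_iInter.2 fun n => h.mem_Xn_of_tailSum_ne_zero hφ hψ n _
    (fun hc => hX (h.core_subset_X hc)) hne)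

theorem tailSum_f (h : T.IsDecomp F) (hφ : ∀ i, φ (T.gamma i) = 0)
    (hψ : ∀ i, ∃ ψ : ℝ →+ ℝ, ∀ j, ψ (T.gamma j) = if j = i then 1 else 0) {w : ℝ}
    (hw : w ∈ core F) : tailSum F φ (T.f w) = tailSum F φ w := by
  obtain ⟨j, hj⟩ := T.exists_mem_piece (h.core_subset_unitIco hw)
  have hwj : T.f w - T.gamma j = w := by rw [T.f_of_mem_piece hj]; ring
  rw [h.tailSum_eq_sum_cut hφ hψ, Finset.sum_eq_single_of_mem j (Finset.mem_univ j)]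
  · rw [T.cut_eq_of_mem (by rwa [hwj]), hwj]
  · intro i _ hij
    by_contra hne
    obtain ⟨h1, h2⟩ := h.mem_piece_of_tailSum_cut_ne_zero hφ hψ hne
    have hf : T.f (T.f w - T.gamma i) = T.f w := by rw [T.f_of_mem_piece h2]; ring
    by_cases hc : T.f w - T.gamma i ∈ core F
    · have := h.injOn_core hc hw hf
      rw [this] at h2
      exact hij (T.piece_unique h2 hj)
    · rw [h1] at hne
      exact hne (h.tailSum_of_notMem_core hφ hψ hc)

theorem sub_tailSum_iterate (h : T.IsDecomp F) (hφ : ∀ i, φ (T.gamma i) = 0)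
    (hψ : ∀ i, ∃ ψ : ℝ →+ ℝ, ∀ j, ψ (T.gamma j) = if j = i then 1 else 0) {w : ℝ}
    (hw : w ∈ core F) (n : ℕ) :
    φ ((T.f)^[n] w) - tailSum F φ ((T.f)^[n] w) = φ w - tailSum F φ w := by
  induction n with
  | zero => rfl
  | succ n ih =>
    have hn := h.iterate_mem_core hw n
    obtain ⟨j, hj⟩ := T.exists_mem_piece (h.core_subset_unitIco hn)
    rw [Function.iterate_succ_apply', h.tailSum_f hφ hψ hn, T.f_of_mem_piece hj, map_add, hφ,
      add_zero, ih]

theorem sub_tailSum_eq (h : T.IsDecomp F) {p : ℝ × ℝ} (hp : p ∈ F) {z w : ℝ}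
    (hz : z ∈ Ico p.1 p.2) (hw : w ∈ Ico p.1 p.2) :
    φ z - tailSum F φ z = φ w - tailSum F φ w := by
  have key : tailSum F φ z - tailSum F φ w = φ z - φ w := by
    rw [tailSum, tailSum, ← Finset.sum_sub_distrib, Finset.sum_eq_single_of_mem p hp]
    · rw [min_eq_right hz.2.le, min_eq_left hz.1, min_eq_right hw.2.le, min_eq_left hw.1]
      ring
    · intro q hq hqp
      have hd := h.disj q hq p hp hqp
      have hlq := h.lt q hq
      have hlp := h.lt p hp
      rw [Set.disjoint_left] at hd
      rcases lt_or_ge q.2 p.1 with hlt | hge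
      · rw [min_eq_left (by linarith [hz.1]), min_eq_left (by linarith [hz.1]),
          min_eq_left (by linarith [hw.1]), min_eq_left (by linarith [hw.1])]
        ring
      · have hqp' : p.2 < q.1 := by
          by_contra! hle
          rcases le_total q.1 p.1 with h' | h'
          · exact hd (a := p.1) ⟨h', hge⟩ ⟨le_rfl, hlp.le⟩
          · exact hd (a := q.1) ⟨le_rfl, hlq.le⟩ ⟨h', hle⟩
        rw [min_eq_right (by linarith [hz.2]), min_eq_right (by linarith [hz.2]),
          min_eq_right (by linarith [hw.2]), min_eq_right (by linarith [hw.2])]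
        ring
  linarith

/-- Two points of one component which land on partition points land on partition points with
equal `φ`-value. -/
theorem map_beta_eq_of_landing (h : T.IsDecomp F) (hφ : ∀ i, φ (T.gamma i) = 0)
    (hψ : ∀ i, ∃ ψ : ℝ →+ ℝ, ∀ j, ψ (T.gamma j) = if j = i then 1 else 0) {p : ℝ × ℝ}
    (hp : p ∈ F) {z w : ℝ} (hz : z ∈ Ico p.1 p.2) (hw : w ∈ Ico p.1 p.2) {m n : ℕ}
    {i j : Fin (r + 1)} (hi : (T.f)^[m] z = T.beta i) (hj : (T.f)^[n] w = T.beta j) :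
    φ (T.beta i) = φ (T.beta j) := by
  have h1 := h.sub_tailSum_iterate hφ hψ (mem_core.2 ⟨p, hp, hz⟩) m
  have h2 := h.sub_tailSum_iterate hφ hψ (mem_core.2 ⟨p, hp, hw⟩) n
  rw [hi, h.tailSum_beta hφ hψ] at h1
  rw [hj, h.tailSum_beta hφ hψ] at h2
  have h3 := h.sub_tailSum_eq (φ := φ) hp hz hw
  linarith

end IsDecomp

end ITM

/-- `K` is a union of at most `n` nondegenerate compact intervals. -/
def IsIccUnion (n : ℕ) (K : Set ℝ) : Prop :=
  ∃ F : Finset (ℝ × ℝ), F.card ≤ n ∧ (∀ p ∈ F, p.1 < p.2) ∧ K = ⋃ p ∈ F, Icc p.1 p.2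

theorem Homeomorph.exists_image_eq_Icc {K L : Set ℝ} (e : K ≃ₜ L) {a b : ℝ} (hab : a < b)
    (hsub : Icc a b ⊆ K) :
    ∃ q : ℝ × ℝ, q.1 < q.2 ∧
      (fun t : K => (e t : ℝ)) '' ((↑) ⁻¹' Icc a b) = Icc q.1 q.2 := by
  set A : Set K := (↑) ⁻¹' Icc a b with hA
  have himg : ((↑) : K → ℝ) '' A = Icc a b := by
    rw [hA, Subtype.image_preimage_coe, inter_eq_self_of_subset_right hsub]
  have hcont : Continuous fun t : K => (e t : ℝ) := by fun_prop
  have hcomp : IsCompact A := by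
    rw [Subtype.isCompact_iff, himg]; exact isCompact_Icc
  have hpre : IsPreconnected A := by
    rw [← Topology.IsInducing.subtypeVal.isPreconnected_image, himg]; exact isPreconnected_Icc
  have ha : a ∈ Icc a b := left_mem_Icc.2 hab.le
  have hb : b ∈ Icc a b := right_mem_Icc.2 hab.le
  have hconn : IsConnected ((fun t : K => (e t : ℝ)) '' A) :=
    ⟨⟨_, ⟨a, hsub ha⟩, ha, rfl⟩, hpre.image _ hcont.continuousOn⟩
  have heq := eq_Icc_of_connected_compact hconn (hcomp.image hcont)
  refine ⟨(_, _), ?_, heq⟩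
  by_contra! hle
  have hss : ((fun t : K => (e t : ℝ)) '' A).Subsingleton := by
    rw [heq]; exact subsingleton_Icc_of_ge hle
  have h := hss ⟨⟨a, hsub ha⟩, ha, rfl⟩ ⟨⟨b, hsub hb⟩, hb, rfl⟩
  have := e.injective (Subtype.coe_injective h)
  exact hab.ne (congrArg Subtype.val this)

theorem IsIccUnion.of_homeomorph {n : ℕ} {K L : Set ℝ} (h : IsIccUnion n K) (e : K ≃ₜ L) :
    IsIccUnion n L := by
  obtain ⟨F, hcard, hlt, rfl⟩ := h
  have hsub : ∀ p ∈ F, Icc p.1 p.2 ⊆ ⋃ p ∈ F, Icc p.1 p.2 := fun p hp =>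
    subset_biUnion_of_mem (u := fun p : ℝ × ℝ => Icc p.1 p.2) hp
  have key : ∀ p : F, ∃ q : ℝ × ℝ, q.1 < q.2 ∧
      (fun t => (e t : ℝ)) '' ((↑) ⁻¹' Icc p.1.1 p.1.2) = Icc q.1 q.2 := fun p =>
    e.exists_image_eq_Icc (hlt p p.2) (hsub p p.2)
  choose g hg hgi using key
  refine ⟨Finset.univ.image g, Finset.card_image_le.trans (by simpa using hcard), ?_, ?_⟩
  · simp only [Finset.mem_image, Finset.mem_univ, true_and, forall_exists_index]
    rintro _ p rfl
    exact hg p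
  · ext y
    simp only [Finset.mem_image, Finset.mem_univ, true_and, mem_iUnion, exists_prop,
      exists_exists_eq_and, ← hgi]
    constructor
    · intro hy
      have hx := (e.symm ⟨y, hy⟩).2
      simp only [mem_iUnion, exists_prop] at hx
      obtain ⟨p, hp, hpx⟩ := hx
      exact ⟨⟨p, hp⟩, e.symm ⟨y, hy⟩, hpx, by simp⟩
    · rintro ⟨p, t, _, rfl⟩
      exact (e t).2

/-- Two members of a family of intervals that meet can be merged. -/
theorem IsIccUnion.merge {K : Set ℝ} {F : Finset (ℝ × ℝ)} (hlt : ∀ p ∈ F, p.1 < p.2)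
    (hK : K = ⋃ p ∈ F, Icc p.1 p.2) {p q : ℝ × ℝ} (hp : p ∈ F) (hq : q ∈ F) (hne : p ≠ q)
    {z : ℝ} (hzp : z ∈ Icc p.1 p.2) (hzq : z ∈ Icc q.1 q.2) : IsIccUnion (F.card - 1) K := by
  have hq' : q ∈ F.erase p := Finset.mem_erase.2 ⟨hne.symm, hq⟩
  refine ⟨insert (min p.1 q.1, max p.2 q.2) ((F.erase p).erase q), ?_, ?_, ?_⟩
  · refine (Finset.card_insert_le _ _).trans ?_
    rw [Finset.card_erase_of_mem hq', Finset.card_erase_of_mem hp]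
    have := Finset.card_pos.2 ⟨q, hq'⟩
    rw [Finset.card_erase_of_mem hp] at this
    omega
  · intro s hs
    rcases Finset.mem_insert.1 hs with rfl | hs
    · exact (min_le_left _ _).trans_lt ((hlt p hp).trans_le (le_max_left _ _))
    · exact hlt s (Finset.mem_of_mem_erase (Finset.mem_of_mem_erase hs))
  · have hun : Icc (min p.1 q.1) (max p.2 q.2) = Icc p.1 p.2 ∪ Icc q.1 q.2 :=
      (Icc_union_Icc' (hzq.1.trans hzp.2) (hzp.1.trans hzq.2)).symm
    rw [hK, Finset.set_biUnion_insert, hun, ← Finset.insert_erase hp, Finset.set_biUnion_insert,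
      ← Finset.insert_erase hq', Finset.set_biUnion_insert, Finset.insert_erase hq',
      Finset.insert_erase hp, union_assoc]

namespace ITM

variable {r : ℕ}

/-- If `X̄` is a finite union of intervals, then all sets `X̄(S)` homeomorphic to it have
decompositions with one and the same number of components. -/
theorem exists_card_decomp {T : ITM r} {n : ℕ} (h : IsIccUnion n T.Xbar) :
    ∃ N : ℕ, ∀ S : ITM r, Nonempty (S.Xbar ≃ₜ T.Xbar) →
      ∃ F : Finset (ℝ × ℝ), F.card = N ∧ S.IsDecomp F := by
  have hex : ∃ n, IsIccUnion n T.Xbar := ⟨n, h⟩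
  refine ⟨Nat.find hex, fun S ⟨e⟩ => ?_⟩
  obtain ⟨F, hcard, hlt, hF⟩ := (Nat.find_spec hex).of_homeomorph e.symm
  have hmin : ∀ m, IsIccUnion m S.Xbar → Nat.find hex ≤ m := fun m hm =>
    Nat.find_min' hex (hm.of_homeomorph e)
  have hcard' : F.card = Nat.find hex := le_antisymm hcard (hmin _ ⟨F, le_rfl, hlt, hF⟩)
  refine ⟨F, hcard', hlt, fun p hp q hq hne => ?_, hF⟩
  rw [Set.disjoint_left]
  intro z hzp hzq
  have h1 := hmin _ (IsIccUnion.merge hlt hF hp hq hne hzp hzq)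
  have h2 := Finset.card_pos.2 ⟨p, hp⟩
  omega

end ITM

theorem exists_pos_forall_le {ι : Type*} [Finite ι] {f : ι → ℝ} (hf : ∀ i, 0 < f i) :
    ∃ κ > 0, ∀ i, κ ≤ f i := by
  rcases isEmpty_or_nonempty ι with h | h
  · exact ⟨1, one_pos, fun i => h.elim i⟩
  · obtain ⟨i₀, hi₀⟩ := Finite.exists_min f
    exact ⟨f i₀, hf i₀, hi₀⟩

namespace ITM

variable {r : ℕ}

theorem pdist_lt_iff {S T : ITM r} {δ : ℝ} (hδ : 0 < δ) :
    pdist S T < δ ↔ (∀ i, |S.gamma i - T.gamma i| < δ) ∧ ∀ i, |S.beta i - T.beta i| < δ := by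
  simp only [pdist, sup_lt_iff, dist_pi_lt_iff hδ, Real.dist_eq]

theorem beta_succ_sub_lt_one (T : ITM r) (i : Fin r) :
    T.beta i.succ - T.beta i.castSucc < 1 := by
  have hr := T.two_le_r
  by_cases h : i.castSucc = 0
  · have h1 : i.succ < Fin.last r := by
      rw [Fin.lt_def]
      have := congrArg Fin.val h
      simp only [Fin.val_castSucc, Fin.val_zero, Fin.val_succ, Fin.val_last] at this ⊢
      omega
    have := T.beta_mono h1
    rw [T.beta_last] at this
    rw [h, T.beta_zero]; linarith
  · have := T.beta_mono (Fin.pos_of_ne_zero h)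
    rw [T.beta_zero] at this
    linarith [T.beta_le_one i.succ]

/-- Arbitrarily close to any parameter there is an open set of parameters. -/
theorem exists_open_parameters (T : ITM r) {δ : ℝ} (hδ : 0 < δ) :
    ∃ g : Fin r → ℝ, ∃ ε > 0, ∀ (b : Fin (r + 1) → ℝ) (c : Fin r → ℝ), b 0 = 0 →
      b (Fin.last r) = 1 → (∀ i, |b i - T.beta i| < ε) → (∀ i, |c i - g i| < ε) →
      ∃ S : ITM r, S.beta = b ∧ S.gamma = c ∧ pdist S T < δ := by
  obtain ⟨κ, hκ, hκle⟩ := exists_pos_forall_le (f := fun i : Fin r =>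
    1 - (T.beta i.succ - T.beta i.castSucc)) fun i => by linarith [T.beta_succ_sub_lt_one i]
  obtain ⟨l, hl, hlle⟩ := exists_pos_forall_le (f := fun i : Fin r =>
    T.beta i.succ - T.beta i.castSucc) fun i => by
      linarith [T.beta_mono (Fin.castSucc_lt_succ (i := i))]
  set η := min (δ / 2) 1 with hη
  have hη0 : 0 < η := lt_min (by linarith) one_pos
  have hη1 : η ≤ 1 := min_le_right _ _
  have hηδ : η ≤ δ / 2 := min_le_left _ _
  have hηκ : 0 < η * κ := mul_pos hη0 hκ
  refine ⟨fun i => T.gamma i + η * ((1 - T.beta i.succ - T.beta i.castSucc) / 2 - T.gamma i),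
    min (min (l / 4) (δ / 4)) (η * κ / 8), by positivity, fun b c hb0 hb1 hb hc => ?_⟩
  set ε := min (min (l / 4) (δ / 4)) (η * κ / 8) with hε
  have hεl : ε ≤ l / 4 := (min_le_left _ _).trans (min_le_left _ _)
  have hεδ : ε ≤ δ / 4 := (min_le_left _ _).trans (min_le_right _ _)
  have hεκ : ε ≤ η * κ / 8 := min_le_right _ _
  refine ⟨⟨b, c, T.two_le_r, hb0, hb1, ?_, ?_⟩, rfl, rfl, ?_⟩
  · refine Fin.strictMono_iff_lt_succ.2 fun i => ?_
    have h1 := abs_lt.1 (hb i.castSucc)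
    have h2 := abs_lt.1 (hb i.succ)
    linarith [hlle i]
  · intro i
    have h1 := abs_lt.1 (hb i.castSucc)
    have h2 := abs_lt.1 (hb i.succ)
    have h3 := abs_lt.1 (hc i)
    have h4 := T.gamma_mem i
    have h5 := hκle i
    have h6 : η * κ ≤ η * (1 - (T.beta i.succ - T.beta i.castSucc)) :=
      mul_le_mul_of_nonneg_left h5 hη0.le
    have h7 : 0 ≤ (1 - η) * (T.gamma i + T.beta i.castSucc) :=
      mul_nonneg (by linarith) (by linarith [h4.1])
    have h8 : 0 ≤ (1 - η) * (1 - T.beta i.succ - T.gamma i) :=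
      mul_nonneg (by linarith) (by linarith [h4.2])
    constructor
    · nlinarith
    · nlinarith
  · refine (pdist_lt_iff hδ).2 ⟨fun i => ?_, fun i => (hb i).trans_le (by linarith)⟩
    have h3 := abs_lt.1 (hc i)
    have h4 := T.gamma_mem i
    have hm := T.beta_mono (Fin.castSucc_lt_succ (i := i))
    have h5 : η * ((1 - T.beta i.succ - T.beta i.castSucc) / 2 - T.gamma i) ≤ η * 1 :=
      mul_le_mul_of_nonneg_left (by linarith [h4.1]) hη0.le
    have h6 : η * (-1) ≤ η * ((1 - T.beta i.succ - T.beta i.castSucc) / 2 - T.gamma i) :=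
      mul_le_mul_of_nonneg_left (by linarith [h4.2]) hη0.le
    rw [abs_lt]
    constructor <;> linarith [h3.1, h3.2]

/-- `A` is a union of blocks `[k/N, (k+1)/N)`. -/
def IsBlockUnion (N : ℕ) (A : Set ℝ) : Prop :=
  ∀ s t : ℝ, ⌊N * s⌋ = ⌊N * t⌋ → s ∈ A → t ∈ A

theorem isBlockUnion_Ico {N : ℕ} (hN : 0 < N) {a b : ℝ} {k l : ℤ} (ha : N * a = k)
    (hb : N * b = l) : IsBlockUnion N (Ico a b) := by
  intro s t hst hs
  have hN' : (0 : ℝ) < N := by exact_mod_cast hN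
  have h1 : k ≤ ⌊N * s⌋ := Int.le_floor.2 (by rw [← ha]; exact mul_le_mul_of_nonneg_left hs.1 hN'.le)
  have h2 : ⌊N * s⌋ < l := Int.floor_lt.2 (by rw [← hb]; exact mul_lt_mul_of_pos_left hs.2 hN')
  rw [hst] at h1 h2
  have h3 := Int.le_floor.1 h1
  have h4 := Int.floor_lt.1 h2
  rw [← ha] at h3
  rw [← hb] at h4
  exact ⟨le_of_mul_le_mul_left h3 hN', lt_of_mul_lt_mul_left h4 hN'.le⟩

theorem isBlockUnion_X {S : ITM r} {N : ℕ} (hN : 0 < N) (hb : ∀ i, ∃ k : ℤ, N * S.beta i = k)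
    (hc : ∀ i, ∃ k : ℤ, N * S.gamma i = k) : IsBlockUnion N S.X := by
  have key : ∀ n, IsBlockUnion N (S.Xn n) := by
    intro n
    induction n with
    | zero =>
      simpa [Xn, unitIco] using
        isBlockUnion_Ico hN (a := 0) (b := 1) (k := 0) (l := N) (by simp) (by simp)
    | succ n ih =>
      rw [Xn_succ]
      rintro s t hst ⟨w, hw, rfl⟩
      obtain ⟨i, hi⟩ := S.exists_mem_piece (S.Xn_subset n hw)
      obtain ⟨k, hk⟩ := hc i
      obtain ⟨a, ha⟩ := hb i.castSucc
      obtain ⟨b, hb⟩ := hb i.succ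
      rw [S.f_of_mem_piece hi, mul_add, hk, Int.floor_add_intCast] at hst
      have hfl : ⌊N * w⌋ = ⌊N * (t - S.gamma i)⌋ := by
        rw [mul_sub, hk, Int.floor_sub_intCast, ← hst]; ring
      refine ⟨t - S.gamma i, ih _ _ hfl hw, ?_⟩
      rw [S.f_of_mem_piece (isBlockUnion_Ico hN ha hb _ _ hfl hi)]; ring
  intro s t hst hs
  exact mem_iInter.2 fun n => key n s t hst (mem_iInter.1 hs n)

theorem IsBlockUnion.isIccUnion_closure {N : ℕ} (hN : 0 < N) {A : Set ℝ} (h : IsBlockUnion N A)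
    (hA : A ⊆ unitIco) : ∃ n, IsIccUnion n (closure A) := by
  have hN' : (0 : ℝ) < N := by exact_mod_cast hN
  set F : Finset (ℝ × ℝ) := ((Finset.range N).filter fun k : ℕ => (k / N : ℝ) ∈ A).image
    fun k : ℕ => ((k / N : ℝ), ((k + 1) / N : ℝ)) with hF
  have hlt : ∀ p ∈ F, p.1 < p.2 := by
    intro p hp
    obtain ⟨k, _, rfl⟩ := Finset.mem_image.1 hp
    exact div_lt_div_of_pos_right (by linarith) hN'
  have hfloor : ∀ (k : ℕ) (t : ℝ), t ∈ Ico (k / N : ℝ) ((k + 1) / N) ↔ ⌊N * t⌋ = k := by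
    intro k t
    rw [Int.floor_eq_iff, mem_Ico, div_le_iff₀ hN', lt_div_iff₀ hN', mul_comm t]
    simp
  have hAeq : A = ⋃ p ∈ F, Ico p.1 p.2 := by
    ext t
    simp only [mem_iUnion, exists_prop]
    constructor
    · intro ht
      have h0 := hA ht
      have h1 : 0 ≤ ⌊N * t⌋ := Int.floor_nonneg.2 (mul_nonneg hN'.le h0.1)
      obtain ⟨k, hk⟩ := Int.eq_ofNat_of_zero_le h1
      have h2 : ⌊N * t⌋ < N := Int.floor_lt.2 (by
        have := mul_lt_mul_of_pos_left h0.2 hN'; simpa using this)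
      refine ⟨_, Finset.mem_image.2 ⟨k, Finset.mem_filter.2 ⟨Finset.mem_range.2 (by omega),
        h t _ ?_ ht⟩, rfl⟩, (hfloor k t).2 hk⟩
      rw [hk, mul_div_cancel₀ _ hN'.ne']; simp
    · rintro ⟨p, hp, hpt⟩
      obtain ⟨k, hk, rfl⟩ := Finset.mem_image.1 hp
      refine h _ t ?_ (Finset.mem_filter.1 hk).2
      rw [(hfloor k t).1 hpt, mul_div_cancel₀ _ hN'.ne']; simp
  refine ⟨F.card, F, le_rfl, hlt, ?_⟩
  rw [hAeq, F.closure_biUnion]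
  exact iUnion₂_congr fun p hp => closure_Ico (hlt p hp).ne

/-- Maps whose attractor has a closure that is a finite union of intervals are dense. -/
theorem exists_near_isIccUnion (T : ITM r) {δ : ℝ} (hδ : 0 < δ) :
    ∃ S : ITM r, pdist S T < δ ∧ ∃ n, IsIccUnion n S.Xbar := by
  obtain ⟨g, ε, hε, H⟩ := T.exists_open_parameters hδ
  obtain ⟨M, hM⟩ := exists_nat_one_div_lt hε
  set N : ℕ := M + 1 with hNM
  have hN : 0 < N := Nat.succ_pos M
  have hN' : (0 : ℝ) < N := by exact_mod_cast hN
  have hclose : ∀ x : ℝ, |(⌊N * x⌋ : ℝ) / N - x| < ε := by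
    intro x
    have h1 := Int.floor_le (N * x)
    have h2 := Int.lt_floor_add_one (N * x)
    have h3 : (1 : ℝ) < N * ε := by
      have := (div_lt_iff₀ (by positivity)).1 hM
      rw [hNM]; push_cast; linarith
    rw [abs_lt, lt_sub_iff_add_lt, sub_lt_iff_lt_add, lt_div_iff₀ hN', div_lt_iff₀ hN']
    constructor <;> nlinarith
  obtain ⟨S, hb, hc, hd⟩ := H (fun i => ⌊N * T.beta i⌋ / N) (fun i => ⌊N * g i⌋ / N)
    (by simp [T.beta_zero]) (by simp [T.beta_last, hN'.ne']) (fun i => hclose _)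
    (fun i => hclose _)
  refine ⟨S, hd, (isBlockUnion_X hN (fun i => ⟨⌊N * T.beta i⌋, ?_⟩)
    fun i => ⟨⌊N * g i⌋, ?_⟩).isIccUnion_closure hN S.X_subset⟩
  · rw [hb]; field_simp
  · rw [hc]; field_simp

end ITM

theorem exists_linearIndependent_near_fin {n : ℕ} (v : Fin n → ℝ) {ε : ℝ} (hε : 0 < ε) :
    ∃ w : Fin n → ℝ, LinearIndependent ℚ w ∧ ∀ i, |w i - v i| < ε := by
  induction n with
  | zero => exact ⟨v, linearIndependent_empty_type, fun i => i.elim0⟩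
  | succ n ih =>
    obtain ⟨w, hw, hwv⟩ := ih fun i => v i.castSucc
    have hcount : (Submodule.span ℚ (range w) : Set ℝ).Countable :=
      countable_coe_iff.1 (inferInstanceAs (Countable (Submodule.span ℚ (range w))))
    obtain ⟨x, hx, hxs⟩ := (hcount.dense_compl ℝ).exists_mem_open
      (isOpen_Ioo (a := v (Fin.last n) - ε) (b := v (Fin.last n) + ε))
      ⟨v (Fin.last n), by linarith, by linarith⟩
    refine ⟨Fin.snoc w x, linearIndependent_finSnoc.2 ⟨hw, hx⟩, fun i => ?_⟩
    refine Fin.lastCases ?_ (fun j => ?_) i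
    · rw [Fin.snoc_last, abs_lt]
      constructor <;> linarith [hxs.1, hxs.2]
    · rw [Fin.snoc_castSucc]; exact hwv j

/-- Families of reals that are linearly independent over `ℚ` are dense. -/
theorem exists_linearIndependent_near {ι : Type*} [Fintype ι] (v : ι → ℝ) {ε : ℝ} (hε : 0 < ε) :
    ∃ w : ι → ℝ, LinearIndependent ℚ w ∧ ∀ i, |w i - v i| < ε := by
  obtain ⟨w, hw, hwv⟩ := exists_linearIndependent_near_fin
    (fun j => v ((Fintype.equivFin ι).symm j)) hε
  refine ⟨w ∘ Fintype.equivFin ι, hw.comp _ (Fintype.equivFin ι).injective, fun i => ?_⟩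
  simpa using hwv (Fintype.equivFin ι i)

theorem LinearIndependent.exists_addMonoidHom {ι : Type*} {w : ι → ℝ} (hw : LinearIndependent ℚ w)
    (c : ι → ℝ) : ∃ φ : ℝ →+ ℝ, ∀ i, φ (w i) = c i := by
  obtain ⟨g, hg⟩ := LinearMap.exists_extend ((Module.Basis.span hw).constr ℚ c)
  refine ⟨g.toAddMonoidHom, fun i => ?_⟩
  have h1 : g (w i) = (g ∘ₗ (Submodule.span ℚ (range w)).subtype) (Module.Basis.span hw i) := by
    simp [Module.Basis.span_apply]
  have h2 : g (w i) = c i := by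
    rw [h1, hg, Module.Basis.constr_basis]
  exact h2

namespace ITM

variable {r : ℕ}

/-- Maps whose parameters are rationally independent, witnessed by additive functionals, are
dense in the parameter space. -/
theorem exists_near_generic (T : ITM r) {δ : ℝ} (hδ : 0 < δ) :
    ∃ S : ITM r, pdist S T < δ ∧
      (∀ i, ∃ ψ : ℝ →+ ℝ, ∀ j, ψ (S.gamma j) = if j = i then 1 else 0) ∧
      ∀ l k : Fin (r + 1), l ≠ 0 → l ≠ Fin.last r → k ≠ 0 → k ≠ Fin.last r → k ≠ l →
        ∃ φ : ℝ →+ ℝ, (∀ i, φ (S.gamma i) = 0) ∧ φ (S.beta l) ≠ φ (S.beta k) := by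
  obtain ⟨g, ε, hε, H⟩ := T.exists_open_parameters hδ
  obtain ⟨w, hw, hwv⟩ := exists_linearIndependent_near (Sum.elim T.beta g) hε
  obtain ⟨S, hb, hc, hd⟩ := H
    (fun i => if i = 0 then 0 else if i = Fin.last r then 1 else w (Sum.inl i))
    (fun i => w (Sum.inr i)) (by simp)
    (by
      have : Fin.last r ≠ 0 := by
        have := T.two_le_r
        rw [Ne, Fin.ext_iff]
        simp only [Fin.val_last, Fin.val_zero]
        omega
      simp [this])
    (fun i => by
      split_ifs with h0 h1
      · simpa [h0, T.beta_zero] using hε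
      · simpa [h1, T.beta_last] using hε
      · exact hwv (Sum.inl i))
    (fun i => hwv (Sum.inr i))
  refine ⟨S, hd, fun i => ?_, fun l k hl hl' hk hk' hkl => ?_⟩
  · obtain ⟨ψ, hψ⟩ := hw.exists_addMonoidHom (Sum.elim 0 fun j => if j = i then 1 else 0)
    exact ⟨ψ, fun j => by rw [hc, hψ]; rfl⟩
  · obtain ⟨φ, hφ⟩ := hw.exists_addMonoidHom (Sum.elim (fun j => if j = l then 1 else 0) 0)
    refine ⟨φ, fun j => by rw [hc, hφ]; rfl, ?_⟩
    rw [hb]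
    simp [hl, hl', hk, hk', hkl, hφ]

end ITM

namespace ITM

variable {r : ℕ}

theorem finite_critSet (T : ITM r) : T.critSet.Finite :=
  (finite_range T.beta).subset fun _ ⟨i, _, _, hi⟩ => ⟨i, hi.symm⟩

/-- The first `n` iterates of `t` avoid `J`. -/
def NoReturn (T : ITM r) (J : Set ℝ) (t : ℝ) (n : ℕ) : Prop :=
  ∀ k, 0 < k → k ≤ n → (T.f)^[k] t ∉ J

theorem noReturn_of_lt_returnTime {T : ITM r} {J : Set ℝ} {t : ℝ} {n : ℕ}
    (h : n < T.returnTime J t) : T.NoReturn J t n := fun _ hk hkn hmem =>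
  Nat.notMem_of_lt_sInf (hkn.trans_lt h) ⟨hk, hmem⟩

theorem lt_returnTime_of_noReturn {T : ITM r} {J : Set ℝ} {t : ℝ} {n k : ℕ}
    (h : T.NoReturn J t n) (hk : 0 < k) (hkJ : (T.f)^[k] t ∈ J) : n < T.returnTime J t := by
  by_contra! hle
  have hmem := Nat.sInf_mem (s := {k : ℕ | 0 < k ∧ (T.f)^[k] t ∈ J}) ⟨k, hk, hkJ⟩
  exact h _ hmem.1 hle hmem.2

theorem returnTime_eq {T : ITM r} {J : Set ℝ} {t : ℝ} {n k : ℕ} (hn : n + 1 = k)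
    (h : T.NoReturn J t n) (hkJ : (T.f)^[k] t ∈ J) : T.returnTime J t = k := by
  refine le_antisymm (Nat.sInf_le ⟨by omega, hkJ⟩) ?_
  have := lt_returnTime_of_noReturn h (by omega) hkJ
  omega

namespace IsDecomp

variable {T : ITM r} {F : Finset (ℝ × ℝ)} {p : ℝ × ℝ}

theorem mem_core_of_mem (hp : p ∈ F) {t : ℝ} (ht : t ∈ Ico p.1 p.2) : t ∈ core F :=
  mem_core.2 ⟨p, hp, ht⟩

theorem snd_notMem_core (h : T.IsDecomp F) (hp : p ∈ F) : p.2 ∉ core F := by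
  intro hc
  obtain ⟨q, hq, hqp⟩ := mem_core.1 hc
  have := h.eq_of_mem hp hq (right_mem_Icc.2 (h.lt p hp).le) (Ico_subset_Icc_self hqp)
  subst this
  exact lt_irrefl _ hqp.2

theorem exists_Ico_subset (h : T.IsDecomp F) {a b : ℝ} (hab : a < b) (hs : Ico a b ⊆ core F) :
    ∃ q ∈ F, Ico a b ⊆ Ico q.1 q.2 := by
  obtain ⟨q, hq, hqa⟩ := mem_core.1 (hs ⟨le_rfl, hab⟩)
  refine ⟨q, hq, Ico_subset_Ico hqa.1 ?_⟩
  by_contra! hlt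
  exact h.snd_notMem_core hq (hs ⟨hqa.2.le, hlt⟩)

theorem exists_eq_of_isIntervalComponent (h : T.IsDecomp F) {J : Set ℝ}
    (hJ : T.IsIntervalComponent J) : ∃ p ∈ F, J = Ico p.1 p.2 := by
  obtain ⟨⟨z, hz, hJz⟩, x, y, hxy, hJe⟩ := hJ
  have hJX : J ⊆ T.X := hJz ▸ connectedComponentIn_subset _ _
  have hcore : Ico x y ⊆ core F := by
    intro t ht
    by_contra hn
    obtain ⟨ε, hε, H⟩ := h.exists_gap hn
    set m := min ε (y - t)
    have hm : 0 < m := lt_min hε (by linarith [ht.2])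
    refine H (t + m / 2) ⟨by linarith, by linarith [min_le_left ε (y - t)]⟩
      (subset_closure (hJX ?_))
    rw [hJe]
    exact ⟨by linarith [ht.1], by linarith [min_le_right ε (y - t)]⟩
  obtain ⟨p, hp, hsub⟩ := h.exists_Ico_subset hxy hcore
  have hxJ : x ∈ J := hJe ▸ ⟨le_rfl, hxy⟩
  refine ⟨p, hp, Subset.antisymm (hJe ▸ hsub) ?_⟩
  rw [hJz, connectedComponentIn_eq (hJz ▸ hxJ)]
  exact isPreconnected_Ico.subset_connectedComponentIn (hsub ⟨le_rfl, hxy⟩)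
    fun t ht => h.core_subset_X (mem_core_of_mem hp ht)

theorem f_eq_add (h : T.IsDecomp F) {a b : ℝ} (hab : a < b) (hs : Ico a b ⊆ core F)
    (hcrit : ∀ t ∈ Ioo a b, t ∉ T.critSet) : ∃ c, ∀ t ∈ Ico a b, T.f t = t + c := by
  obtain ⟨i, hi⟩ := T.exists_mem_piece (h.core_subset_unitIco (hs ⟨le_rfl, hab⟩))
  have hb : b ≤ T.beta i.succ := by
    by_contra! hlt
    refine hcrit _ ⟨hi.2, hlt⟩ ⟨i.succ, Fin.succ_ne_zero i, fun hlast => ?_, rfl⟩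
    have := (h.core_subset_unitIco (hs ⟨hi.2.le, hlt⟩)).2
    rw [hlast, T.beta_last] at this
    exact lt_irrefl _ this
  exact ⟨T.gamma i, fun t ht => T.f_of_mem_piece ⟨hi.1.trans ht.1, ht.2.trans_le hb⟩⟩

theorem iterate_eq_add (h : T.IsDecomp F) {a b : ℝ} (hab : a < b) (hs : Ico a b ⊆ core F) {k : ℕ}
    (hcrit : ∀ t ∈ Ioo a b, ∀ j < k, (T.f)^[j] t ∉ T.critSet) :
    ∃ c, ∀ t ∈ Ico a b, (T.f)^[k] t = t + c := by
  induction k with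
  | zero => exact ⟨0, fun t _ => by simp⟩
  | succ k ih =>
    obtain ⟨c, hc⟩ := ih fun t ht j hj => hcrit t ht j (hj.trans k.lt_succ_self)
    have hback : ∀ t ∈ Ico (a + c) (b + c), (T.f)^[k] (t - c) = t := fun t ht => by
      rw [hc _ ⟨by linarith [ht.1], by linarith [ht.2]⟩]; ring
    obtain ⟨d, hd⟩ := h.f_eq_add (a := a + c) (b := b + c) (by linarith)
      (fun t ht => by
        rw [← hback t ht]
        exact h.iterate_mem_core (hs ⟨by linarith [ht.1], by linarith [ht.2]⟩) k)
      (fun t ht => by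
        rw [← hback t (Ioo_subset_Ico_self ht)]
        exact hcrit _ ⟨by linarith [ht.1], by linarith [ht.2]⟩ k k.lt_succ_self)
    refine ⟨c + d, fun t ht => ?_⟩
    rw [Function.iterate_succ_apply', hc t ht, hd _ ⟨by linarith [ht.1], by linarith [ht.2]⟩]
    ring

theorem eq_iterate_of_iterate_eq (h : T.IsDecomp F) {s t : ℝ} (hs : s ∈ core F) (ht : t ∈ core F)
    {m n : ℕ} (hmn : m ≤ n) (heq : (T.f)^[m] s = (T.f)^[n] t) : s = (T.f)^[n - m] t := by
  refine h.iterate_injOn_core m hs (h.iterate_mem_core ht _) ?_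
  rw [heq, ← Function.iterate_add_apply, Nat.add_sub_cancel' hmn]

/-- Orbits of different points of a component do not meet before they return. -/
theorem eq_of_noReturn (h : T.IsDecomp F) (hp : p ∈ F) {s t : ℝ} (hs : s ∈ Ico p.1 p.2)
    (ht : t ∈ Ico p.1 p.2) {m n : ℕ} (hm : T.NoReturn (Ico p.1 p.2) s m)
    (hn : T.NoReturn (Ico p.1 p.2) t n) (heq : (T.f)^[m] s = (T.f)^[n] t) : s = t := by
  wlog hmn : m ≤ n generalizing s t m n
  · exact (this ht hs hn hm heq.symm (not_le.1 hmn).le).symm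
  have key := h.eq_iterate_of_iterate_eq (mem_core_of_mem hp hs) (mem_core_of_mem hp ht) hmn heq
  rcases hmn.eq_or_lt with rfl | hlt
  · simpa using key
  · exact absurd (key ▸ hs) (hn (n - m) (by omega) (by omega))

/-- A subinterval of a component none of whose interior points meets a discontinuity before
returning returns as a whole, by a translation. -/
theorem exists_return_Ico (h : T.IsDecomp F) (hp : p ∈ F) {a b : ℝ} (hab : a < b)
    (hs : Ico a b ⊆ Ico p.1 p.2)
    (hcrit : ∀ t ∈ Ioo a b, ∀ n, T.NoReturn (Ico p.1 p.2) t n → (T.f)^[n] t ∉ T.critSet) :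
    ∃ (n : ℕ) (c : ℝ), ∀ t ∈ Ico a b, T.NoReturn (Ico p.1 p.2) t n ∧
      (T.f)^[n + 1] t = t + c ∧ t + c ∈ Ico p.1 p.2 := by
  set J := Ico p.1 p.2 with hJ
  have hsc : Ico a b ⊆ core F := fun t ht => mem_core_of_mem hp (hs ht)
  have hcrit' : ∀ n, (∀ t ∈ Ico a b, T.NoReturn J t n) →
      ∃ c, ∀ t ∈ Ico a b, (T.f)^[n + 1] t = t + c := fun n hn =>
    h.iterate_eq_add hab hsc fun t ht j hj => hcrit t ht j fun k hk hkj =>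
      hn t (Ioo_subset_Ico_self ht) k hk (by omega)
  by_contra! hcon
  have hall : ∀ n, ∀ t ∈ Ico a b, T.NoReturn J t n := by
    intro n
    induction n with
    | zero => exact fun t _ k hk hk' => by omega
    | succ n ih =>
      obtain ⟨c, hc⟩ := hcrit' n ih
      obtain ⟨t₀, ht₀, H⟩ := hcon n c
      have hout := H (ih t₀ ht₀) (hc t₀ ht₀)
      obtain ⟨q, hq, hqs⟩ := h.exists_Ico_subset (a := a + c) (b := b + c) (by linarith)
        fun t ht => by
          have hmem : t - c ∈ Ico a b := ⟨by linarith [ht.1], by linarith [ht.2]⟩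
          have := h.iterate_mem_core (hsc hmem) (n + 1)
          rwa [hc _ hmem, sub_add_cancel] at this
      have hshift : ∀ t ∈ Ico a b, t + c ∈ Ico q.1 q.2 := fun t ht =>
        hqs ⟨by linarith [ht.1], by linarith [ht.2]⟩
      intro t ht k hk hkn hkJ
      rcases Nat.lt_or_ge k (n + 1) with hlt | hge
      · exact ih t ht k hk (by omega) hkJ
      · have hkn' : k = n + 1 := by omega
        subst hkn'
        rw [hc t ht] at hkJ
        have hpq := h.eq_of_mem hp hq (Ico_subset_Icc_self hkJ)
          (Ico_subset_Icc_self (hshift t ht))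
        subst hpq
        exact hout (hshift t₀ ht₀)
  have htrans : ∀ n, ∃ c, ∀ t ∈ Ico a b, (T.f)^[n] t = t + c := by
    intro n
    cases n with
    | zero => exact ⟨0, fun t _ => by simp⟩
    | succ n => exact hcrit' n (hall n)
  have ha : a ∈ Ico a b := ⟨le_rfl, hab⟩
  have hba : 0 < b - a := sub_pos.2 hab
  obtain ⟨m, -, n, -, hmn, hfl⟩ := (infinite_univ (α := ℕ)).exists_ne_map_eq_of_mapsTo
    (f := fun n => ⌊(T.f)^[n] a / (b - a)⌋) (t := Icc 0 ⌊1 / (b - a)⌋)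
    (fun n _ => by
      have := h.core_subset_unitIco (h.iterate_mem_core (hsc ha) n)
      exact ⟨Int.floor_nonneg.2 (div_nonneg this.1 hba.le),
        Int.floor_le_floor (div_le_div_of_nonneg_right this.2.le hba.le)⟩) (finite_Icc _ _)
  wlog hle : (T.f)^[m] a ≤ (T.f)^[n] a generalizing m n
  · exact this n m hmn.symm hfl.symm (not_le.1 hle).le
  have hlt : (T.f)^[n] a - (T.f)^[m] a < b - a := by
    have := (abs_lt.1 (Int.abs_sub_lt_one_of_floor_eq_floor hfl)).1
    rw [← sub_div, lt_div_iff₀ hba] at this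
    linarith
  set s := a + ((T.f)^[n] a - (T.f)^[m] a) with hsdef
  have hsm : s ∈ Ico a b := ⟨by linarith, by linarith⟩
  have hiter : (T.f)^[m] s = (T.f)^[n] a := by
    obtain ⟨c, hc⟩ := htrans m
    rw [hc s hsm, hsdef, hc a ha]; ring
  rcases Nat.lt_or_ge m n with h1 | h1
  · have := h.eq_iterate_of_iterate_eq (hsc hsm) (hsc ha) h1.le hiter
    exact hall (n - m) a ha (n - m) (by omega) le_rfl (this ▸ hs hsm)
  · have := h.eq_iterate_of_iterate_eq (hsc ha) (hsc hsm) h1 hiter.symm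
    exact hall (m - n) s hsm (m - n) (by omega) le_rfl (this ▸ hs ha)

/-- Every point of a component returns to it. -/
theorem exists_return (h : T.IsDecomp F) (hp : p ∈ F) {a : ℝ} (ha : a ∈ Ico p.1 p.2) :
    ∃ k, 0 < k ∧ (T.f)^[k] a ∈ Ico p.1 p.2 := by
  set J := Ico p.1 p.2 with hJ
  set D := {t | t ∈ J ∧ ∃ n, T.NoReturn J t n ∧ (T.f)^[n] t ∈ T.critSet} with hD
  have hfin : D.Finite := by
    have hch : ∀ t : ℝ, ∃ n, t ∈ D → T.NoReturn J t n ∧ (T.f)^[n] t ∈ T.critSet := by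
      intro t
      by_cases ht : t ∈ D
      · obtain ⟨n, hn⟩ := ht.2
        exact ⟨n, fun _ => hn⟩
      · exact ⟨0, fun h => absurd h ht⟩
    choose g hg using hch
    refine Set.Finite.of_injOn (f := fun t => (T.f)^[g t] t) (fun t ht => (hg t ht).2) ?_
      T.finite_critSet
    intro s hs t ht hst
    exact h.eq_of_noReturn hp hs.1 ht.1 (hg s hs).1 (hg t ht).1 hst
  obtain ⟨ε, hε, hball⟩ := Metric.isOpen_iff.1
    (hfin.subset (sdiff_subset (t := {a}))).isClosed.isOpen_compl a (by simp)
  set m := min ε (p.2 - a)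
  have hm : 0 < m := lt_min hε (by linarith [ha.2])
  obtain ⟨n, c, H⟩ := h.exists_return_Ico hp (a := a) (b := a + m) (by linarith)
    (Ico_subset_Ico ha.1 (by linarith [min_le_right ε (p.2 - a)])) (by
      intro t ht n hn hc
      refine hball (a := t) ?_ ⟨⟨⟨by linarith [ht.1, ha.1], ?_⟩, n, hn, hc⟩, ht.1.ne'⟩
      · rw [Metric.mem_ball, Real.dist_eq, abs_lt]
        constructor <;> linarith [ht.1, ht.2, min_le_left ε (p.2 - a)]
      · linarith [ht.2, min_le_right ε (p.2 - a)])
  obtain ⟨_, h1, h2⟩ := H a ⟨le_rfl, by linarith⟩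
  exact ⟨n + 1, n.succ_pos, h1 ▸ h2⟩

/-- A dynamically non-trivial component contains an interior point that lands on a discontinuity
before it returns. -/
theorem exists_landing (h : T.IsDecomp F) (hp : p ∈ F)
    (hJ : T.IsIntervalComponent (Ico p.1 p.2)) (hnt : ¬ T.DynTrivial (Ico p.1 p.2)) :
    ∃ a ∈ interior (Ico p.1 p.2), ∃ k < T.returnTime (Ico p.1 p.2) a,
      (T.f)^[k] a ∈ T.critSet := by
  by_contra! hno
  apply hnt
  obtain ⟨n, c, H⟩ := h.exists_return_Ico hp (h.lt p hp) subset_rfl (by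
    intro t ht n hn
    obtain ⟨k, hk, hkJ⟩ := h.exists_return hp (Ioo_subset_Ico_self ht)
    exact hno t (by rwa [interior_Ico]) n (lt_returnTime_of_noReturn hn hk hkJ))
  have hlt := h.lt p hp
  have hc : c = 0 := by
    have h1 := (H p.1 ⟨le_rfl, hlt⟩).2.2.1
    by_contra hne
    have hpos : 0 < c := lt_of_le_of_ne (by linarith) (Ne.symm hne)
    have h2 := (H (max p.1 (p.2 - c)) ⟨le_max_left _ _, max_lt hlt (by linarith)⟩).2.2.2
    linarith [le_max_right p.1 (p.2 - c)]
  subst hc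
  have hret : ∀ t ∈ Ico p.1 p.2, T.returnTime (Ico p.1 p.2) t = n + 1 := fun t ht => by
    obtain ⟨h1, h2, h3⟩ := H t ht
    exact returnTime_eq rfl h1 (h2 ▸ h3)
  have hper : ∀ t ∈ Ico p.1 p.2, (T.f)^[n + 1] t = t := fun t ht => by
    rw [(H t ht).2.1, add_zero]
  refine ⟨hJ, fun a ha ⟨k, hk⟩ => ?_, fun z hz => by rw [returnMap, hret z hz, hper z hz]⟩
  have haJ := interior_subset ha
  have hp' : Function.IsPeriodicPt T.f (n + 1) a := hper a haJ
  rw [← hp'.iterate_mod_apply] at hk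
  exact hno a ha _ (by rw [hret a haJ]; exact Nat.mod_lt _ n.succ_pos) hk

end IsDecomp

end ITM

namespace ITM

variable {r : ℕ}

theorem pdist_self_lt (T : ITM r) {η : ℝ} (hη : 0 < η) : pdist T T < η :=
  (pdist_lt_iff hη).2 ⟨fun _ => by simpa using hη, fun _ => by simpa using hη⟩

theorem mem_piece_idx (T : ITM r) {x : ℝ} (hx : x ∈ unitIco) :
    x ∈ Ico (T.beta (T.idx x).castSucc) (T.beta (T.idx x).succ) := by
  have h := T.exists_mem_piece hx
  rw [idx, dif_pos h]
  exact h.choose_spec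

/-- Until an orbit meets a discontinuity, its itinerary persists under small perturbations of the
map and of the point. -/
theorem exists_iterate_eq_add (T : ITM r) {a : ℝ} (ha : a ∈ Ioo (0 : ℝ) 1) {k : ℕ}
    (hk : ∀ l < k, (T.f)^[l] a ∉ T.critSet) {ρ : ℝ} (hρ : 0 < ρ) :
    ∃ η > 0, ∀ S : ITM r, pdist S T < η → ∀ a', |a' - a| < η →
      (S.f)^[k] a' = a' + ∑ l ∈ Finset.range k, S.gamma (T.idx ((T.f)^[l] a)) ∧
      |(S.f)^[k] a' - (T.f)^[k] a| < ρ := by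
  induction k generalizing ρ with
  | zero => exact ⟨ρ, hρ, fun S _ a' ha' => ⟨by simp, by simpa using ha'⟩⟩
  | succ k ih =>
    replace ih := @ih fun l hl => hk l (hl.trans k.lt_succ_self)
    set t := (T.f)^[k] a with ht
    have htm : t ∈ unitIco := T.f_iterate_mem (Ioo_subset_Ico_self ha) k
    have hpos : 0 < t := by
      obtain ⟨η, hη, H⟩ := ih one_pos
      have h1 := (H T (T.pdist_self_lt hη) a (by simpa using hη)).1
      set s := min (η / 2) (a / 2)
      have hs : 0 < s := lt_min (by linarith) (by linarith [ha.1])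
      have h2 := (H T (T.pdist_self_lt hη) (a - s) (by
        rw [abs_lt]; constructor <;> linarith [min_le_left (η / 2) (a / 2)])).1
      have h3 : (T.f)^[k] (a - s) ∈ unitIco := T.f_iterate_mem
        ⟨by linarith [min_le_right (η / 2) (a / 2), ha.1], by linarith [ha.2]⟩ k
      linarith [h3.1]
    set i := T.idx t with hi
    have hti := T.mem_piece_idx htm
    have hlt : T.beta i.castSucc < t := by
      refine lt_of_le_of_ne hti.1 fun heq => ?_
      by_cases h0 : i.castSucc = 0
      · rw [h0, T.beta_zero] at heq
        exact hpos.ne heq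
      · exact hk k k.lt_succ_self ⟨_, h0, (Fin.castSucc_lt_last i).ne, heq.symm⟩
    set m := min (t - T.beta i.castSucc) (T.beta i.succ - t) with hm
    have hm0 : 0 < m := lt_min (by linarith) (by linarith [hti.2])
    have hm1 : m ≤ t - T.beta i.castSucc := min_le_left _ _
    have hm2 : m ≤ T.beta i.succ - t := min_le_right _ _
    set ρ' := min (ρ / 2) (m / 2)
    have hρ' : 0 < ρ' := lt_min (by linarith) (by linarith)
    have hρ1 : ρ' ≤ ρ / 2 := min_le_left _ _
    have hρ2 : ρ' ≤ m / 2 := min_le_right _ _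
    obtain ⟨η, hη, H⟩ := ih hρ'
    refine ⟨min η ρ', lt_min hη hρ', fun S hS a' ha' => ?_⟩
    obtain ⟨h1, h2⟩ := H S (hS.trans_le (min_le_left _ _)) a' (ha'.trans_le (min_le_left _ _))
    obtain ⟨hSg, hSb⟩ := (pdist_lt_iff hρ').1 (hS.trans_le (min_le_right _ _))
    have h3 := abs_lt.1 h2
    have h4 := abs_lt.1 (hSb i.castSucc)
    have h5 := abs_lt.1 (hSb i.succ)
    have h6 := abs_lt.1 (hSg i)
    have hS' : (S.f)^[k + 1] a' = (S.f)^[k] a' + S.gamma i := by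
      rw [Function.iterate_succ_apply']
      exact S.f_of_mem_piece ⟨by linarith, by linarith⟩
    have hT' : (T.f)^[k + 1] a = t + T.gamma i := by
      rw [Function.iterate_succ_apply']
      exact T.f_of_mem_piece hti
    refine ⟨?_, ?_⟩
    · rw [hS', Finset.sum_range_succ, h1, add_assoc]
    · rw [hS', hT', abs_lt]
      constructor <;> linarith

/-- A point landing on a discontinuity persists under small perturbations. -/
theorem exists_near_landing (T : ITM r) {a : ℝ} (ha : a ∈ Ioo (0 : ℝ) 1) {k : ℕ}
    (hk : ∀ l < k, (T.f)^[l] a ∉ T.critSet) {i : Fin (r + 1)} (hi : (T.f)^[k] a = T.beta i)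
    {ρ : ℝ} (hρ : 0 < ρ) :
    ∃ η > 0, ∀ S : ITM r, pdist S T < η → ∃ a', |a' - a| < ρ ∧ (S.f)^[k] a' = S.beta i := by
  obtain ⟨η₁, hη₁, H₁⟩ := T.exists_iterate_eq_add ha hk hρ
  obtain ⟨η, hη, H⟩ := T.exists_iterate_eq_add ha hk
    (ρ := min (η₁ / 2) (ρ / 2)) (lt_min (by linarith) (by linarith))
  refine ⟨min (min η η₁) (min (η₁ / 2) (ρ / 2)), by positivity, fun S hS => ?_⟩
  have hSη : pdist S T < η := hS.trans_le ((min_le_left _ _).trans (min_le_left _ _))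
  have hSη₁ : pdist S T < η₁ := hS.trans_le ((min_le_left _ _).trans (min_le_right _ _))
  obtain ⟨h1, h2⟩ := H S hSη a (by simpa using hη)
  have h3 := abs_lt.1 (((pdist_lt_iff (by positivity)).1
    (hS.trans_le (min_le_right _ _))).2 i)
  rw [hi] at h2
  have h4 := abs_lt.1 h2
  have hm1 : min (η₁ / 2) (ρ / 2) ≤ η₁ / 2 := min_le_left _ _
  have hm2 : min (η₁ / 2) (ρ / 2) ≤ ρ / 2 := min_le_right _ _
  refine ⟨a + (S.beta i - (S.f)^[k] a), ?_, ?_⟩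
  · rw [abs_lt]; constructor <;> linarith
  · rw [(H₁ S hSη₁ _ (by rw [abs_lt]; constructor <;> linarith)).1, h1]
    ring

namespace IsDecomp

variable {T : ITM r} {F : Finset (ℝ × ℝ)}

theorem exists_separation (h : T.IsDecomp F) :
    ∃ g > 0, ∀ p ∈ F, ∀ q ∈ F, p ≠ q → p.2 + g ≤ q.1 ∨ q.2 + g ≤ p.1 := by
  obtain ⟨κ, hκ, H⟩ := exists_pos_forall_le
    (f := fun s : {s : F × F // s.1 ≠ s.2} =>
      max (s.1.2.1.1 - s.1.1.1.2) (s.1.1.1.1 - s.1.2.1.2)) (by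
    rintro ⟨⟨⟨p, hp⟩, ⟨q, hq⟩⟩, hne⟩
    have hne' : p ≠ q := fun h0 => hne (Subtype.ext h0)
    by_contra! hle
    have h1 := (le_max_left _ _).trans hle
    have h2 := (le_max_right _ _).trans hle
    simp only [sub_nonpos] at h1 h2
    have hp' := h.lt p hp
    have hq' := h.lt q hq
    have hmem : max p.1 q.1 ∈ Icc p.1 p.2 := ⟨le_max_left _ _, max_le hp'.le h1⟩
    exact Set.disjoint_left.1 (h.disj p hp q hq hne') hmem
      ⟨le_max_right _ _, max_le h2 hq'.le⟩)
  refine ⟨κ, hκ, fun p hp q hq hne => ?_⟩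
  have := H ⟨⟨⟨p, hp⟩, ⟨q, hq⟩⟩, fun h0 => hne (congrArg Subtype.val h0)⟩
  rcases le_max_iff.1 this with h1 | h1
  · left; simp only at h1; linarith
  · right; simp only at h1; linarith

/-- Decompositions with the same number of components of Hausdorff-close sets match. -/
theorem exists_matching (h : T.IsDecomp F) {ρ : ℝ} (hρ : 0 < ρ) :
    ∃ η > 0, ∀ (S : ITM r) (G : Finset (ℝ × ℝ)), S.IsDecomp G → G.card = F.card →
      (∀ z ∈ S.Xbar, ∃ u ∈ T.Xbar, dist z u < η) → (∀ u ∈ T.Xbar, ∃ z ∈ S.Xbar, dist z u < η) →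
      ∀ p ∈ F, ∃ q ∈ G, q.1 < p.1 + ρ ∧ p.2 - ρ < q.2 := by
  obtain ⟨g, hg, hsep⟩ := h.exists_separation
  refine ⟨min ρ (g / 2), lt_min hρ (by linarith), fun S G hG hcard hST hTS => ?_⟩
  set η := min ρ (g / 2)
  have hηρ : η ≤ ρ := min_le_left _ _
  have hηg : η ≤ g / 2 := min_le_right _ _
  set U : ℝ × ℝ → Set ℝ := fun p => Ioo (p.1 - η) (p.2 + η) with hU
  have hUdisj : ∀ p ∈ F, ∀ q ∈ F, ∀ z, z ∈ U p → z ∈ U q → p = q := by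
    intro p hp q hq z hzp hzq
    by_contra hne
    rcases hsep p hp q hq hne with h1 | h1
    · linarith [hzp.2, hzq.1]
    · linarith [hzp.1, hzq.2]
  have hUmem : ∀ p z u, u ∈ Icc p.1 p.2 → dist z u < η → z ∈ U p := by
    intro p z u hu hd
    rw [Real.dist_eq, abs_lt] at hd
    exact ⟨by linarith [hu.1], by linarith [hu.2]⟩
  have hcov : ∀ z ∈ S.Xbar, ∃ p ∈ F, z ∈ U p := by
    intro z hz
    obtain ⟨u, hu, hzu⟩ := hST z hz
    obtain ⟨p, hp, hpu⟩ := h.mem_Xbar.1 hu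
    exact ⟨p, hp, hUmem p z u hpu hzu⟩
  have hkey : ∀ q : G, ∃ p : F, Icc q.1.1 q.1.2 ⊆ U p := by
    rintro ⟨q, hq⟩
    have hqX : Icc q.1 q.2 ⊆ S.Xbar := fun z hz => hG.mem_Xbar.2 ⟨q, hq, hz⟩
    have hq1 : q.1 ∈ Icc q.1 q.2 := left_mem_Icc.2 (hG.lt q hq).le
    obtain ⟨p, hp, hpq⟩ := hcov q.1 (hqX hq1)
    refine ⟨⟨p, hp⟩, isPreconnected_Icc.subset_left_of_subset_union isOpen_Ioo
      (v := ⋃ s ∈ F.erase p, U s) (isOpen_biUnion fun _ _ => isOpen_Ioo) ?_ ?_ ⟨q.1, hq1, hpq⟩⟩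
    · rw [Set.disjoint_left]
      intro z hz hz'
      simp only [mem_iUnion, exists_prop] at hz'
      obtain ⟨s, hs, hzs⟩ := hz'
      exact Finset.ne_of_mem_erase hs (hUdisj s (Finset.mem_of_mem_erase hs) p hp z hzs hz)
    · intro z hz
      obtain ⟨s, hs, hzs⟩ := hcov z (hqX hz)
      by_cases hsp : s = p
      · exact Or.inl (hsp ▸ hzs)
      · exact Or.inr (mem_biUnion (Finset.mem_coe.2 (Finset.mem_erase.2 ⟨hsp, hs⟩)) hzs)
  choose c hc using hkey
  have hval : ∀ (q : G) (p : F) (z : ℝ), z ∈ Icc q.1.1 q.1.2 → z ∈ U p → c q = p :=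
    fun q p z hzq hzp => Subtype.ext (hUdisj _ (c q).2 _ p.2 z (hc q hzq) hzp)
  have hnear : ∀ (p : F) (u : ℝ), u ∈ Icc p.1.1 p.1.2 →
      ∃ q : G, ∃ z ∈ Icc q.1.1 q.1.2, dist z u < η ∧ c q = p := by
    intro p u hu
    obtain ⟨z, hz, hzu⟩ := hTS u (h.mem_Xbar.2 ⟨p, p.2, hu⟩)
    obtain ⟨q, hq, hqz⟩ := hG.mem_Xbar.1 hz
    exact ⟨⟨q, hq⟩, z, hqz, hzu, hval ⟨q, hq⟩ p z hqz (hUmem p z u hu hzu)⟩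
  have hsurj : Function.Surjective c := fun p => by
    obtain ⟨q, _, _, _, hq⟩ := hnear p p.1.1 (left_mem_Icc.2 (h.lt p p.2).le)
    exact ⟨q, hq⟩
  have hinj : Function.Injective c :=
    ((Fintype.bijective_iff_surjective_and_card c).2 ⟨hsurj, by simpa using hcard⟩).1
  intro p hp
  obtain ⟨q₁, z₁, hz₁, hd₁, hq₁⟩ := hnear ⟨p, hp⟩ p.1 (left_mem_Icc.2 (h.lt p hp).le)
  obtain ⟨q₂, z₂, hz₂, hd₂, hq₂⟩ := hnear ⟨p, hp⟩ p.2 (right_mem_Icc.2 (h.lt p hp).le)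
  obtain rfl : q₁ = q₂ := hinj (hq₁.trans hq₂.symm)
  rw [Real.dist_eq, abs_lt] at hd₁ hd₂
  exact ⟨q₁, q₁.2, by linarith [hz₁.1], by linarith [hz₂.2]⟩

end IsDecomp

/-- Near a stable map, all closures of attractors decompose into the same number of intervals. -/
theorem Stable.exists_card_decomp {T : ITM r} (hT : T.Stable) :
    ∃ δ > 0, ∃ N : ℕ, ∀ S : ITM r, pdist S T < δ →
      ∃ F : Finset (ℝ × ℝ), F.card = N ∧ S.IsDecomp F := by
  obtain ⟨δ, hδ, hhom, -, -⟩ := hT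
  obtain ⟨S₀, hS₀, n, hn⟩ := T.exists_near_isIccUnion hδ
  obtain ⟨e⟩ := hhom S₀ hS₀
  obtain ⟨N, hN⟩ := ITM.exists_card_decomp (hn.of_homeomorph e)
  exact ⟨δ, hδ, N, fun S hS => hN S (hhom S hS)⟩

/-- Maps close to a stable map `T` have an attractor with closure Hausdorff-close to `X̄(T)`. -/
theorem Stable.exists_dist_lt {T : ITM r} (hT : T.Stable) (hne : T.Xbar.Nonempty) {ε : ℝ}
    (hε : 0 < ε) : ∃ η > 0, ∀ S : ITM r, pdist S T < η →
      (∀ z ∈ S.Xbar, ∃ u ∈ T.Xbar, dist z u < ε) ∧ ∀ u ∈ T.Xbar, ∃ z ∈ S.Xbar, dist z u < ε := by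
  obtain ⟨δ, hδ, hhom, hcont, -⟩ := hT
  obtain ⟨η, hη, H⟩ := hcont T (T.pdist_self_lt hδ) ε hε
  refine ⟨min δ η, lt_min hδ hη, fun S hS => ?_⟩
  have hSδ := hS.trans_le (min_le_left δ η)
  have hd := H S hSδ (hS.trans_le (min_le_right δ η))
  obtain ⟨e⟩ := hhom S hSδ
  have hSne : S.Xbar.Nonempty := ⟨_, (e.symm ⟨_, hne.some_mem⟩).2⟩
  have hfin := Metric.hausdorffEDist_ne_top_of_nonempty_of_bounded hSne hne
    (Metric.isBounded_Icc (0 : ℝ) 1 |>.subset S.Xbar_subset)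
    (Metric.isBounded_Icc (0 : ℝ) 1 |>.subset T.Xbar_subset)
  exact ⟨fun z hz => Metric.exists_dist_lt_of_hausdorffDist_lt hz hd hfin,
    fun u hu => Metric.exists_dist_lt_of_hausdorffDist_lt' hu hd hfin⟩

/-- The first landing of a point that lands on a discontinuity before it returns. -/
theorem exists_first_landing {T : ITM r} {J : Set ℝ} {a : ℝ}
    (h : ∃ k < T.returnTime J a, (T.f)^[k] a ∈ T.critSet) :
    ∃ k, T.NoReturn J a k ∧ (∀ l < k, (T.f)^[l] a ∉ T.critSet) ∧
      ∃ i, i ≠ 0 ∧ i ≠ Fin.last r ∧ (T.f)^[k] a = T.beta i := by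
  obtain ⟨k, hk, hcrit⟩ := h
  have hex : ∃ k, (T.f)^[k] a ∈ T.critSet := ⟨k, hcrit⟩
  exact ⟨Nat.find hex, noReturn_of_lt_returnTime ((Nat.find_min' hex hcrit).trans_lt hk),
    fun l hl => Nat.find_min hex hl, Nat.find_spec hex⟩

/-- For a stable map, at most one interior point of a component lands on a discontinuity before
it returns. -/
theorem Stable.landing_unique {T : ITM r} (hT : T.Stable) {F : Finset (ℝ × ℝ)}
    (h : T.IsDecomp F) {δ : ℝ} (hδ : 0 < δ)
    (hcard : ∀ S : ITM r, pdist S T < δ →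
      ∃ G : Finset (ℝ × ℝ), G.card = F.card ∧ S.IsDecomp G)
    {p : ℝ × ℝ} (hp : p ∈ F) {a b : ℝ} (ha : a ∈ interior (Ico p.1 p.2))
    (hb : b ∈ interior (Ico p.1 p.2))
    (hal : ∃ k < T.returnTime (Ico p.1 p.2) a, (T.f)^[k] a ∈ T.critSet)
    (hbl : ∃ k < T.returnTime (Ico p.1 p.2) b, (T.f)^[k] b ∈ T.critSet) : a = b := by
  have hIoo : ∀ t ∈ Ioo p.1 p.2, t ∈ Ioo (0 : ℝ) 1 := fun t ht =>
    ⟨(h.core_subset_unitIco (IsDecomp.mem_core_of_mem hp ⟨le_rfl, h.lt p hp⟩)).1.trans_lt ht.1,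
      (h.core_subset_unitIco (IsDecomp.mem_core_of_mem hp (Ioo_subset_Ico_self ht))).2⟩
  rw [interior_Ico] at ha hb
  obtain ⟨m, hm, hm', i, hi0, hi1, hi⟩ := exists_first_landing hal
  obtain ⟨n, hn, hn', j, hj0, hj1, hj⟩ := exists_first_landing hbl
  by_cases hij : j = i
  · subst hij
    exact h.eq_of_noReturn hp (Ioo_subset_Ico_self ha) (Ioo_subset_Ico_self hb) hm hn
      (hi.trans hj.symm)
  exfalso
  obtain ⟨ρ, hρ, ha1, ha2, hb1, hb2⟩ : ∃ ρ > 0, p.1 + 2 * ρ ≤ a ∧ a ≤ p.2 - 2 * ρ ∧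
      p.1 + 2 * ρ ≤ b ∧ b ≤ p.2 - 2 * ρ := by
    obtain ⟨κ, hκ, H⟩ := exists_pos_forall_le
      (f := ![a - p.1, p.2 - a, b - p.1, p.2 - b]) (by
        intro k
        fin_cases k <;> simp [ha.1, ha.2, hb.1, hb.2])
    have h0 := H 0
    have h1 := H 1
    have h2 := H 2
    have h3 := H 3
    simp at h0 h1 h2 h3
    exact ⟨κ / 2, by linarith, by linarith, by linarith, by linarith, by linarith⟩
  obtain ⟨η₁, hη₁, H₁⟩ := T.exists_near_landing (hIoo a ha) hm' hi hρ
  obtain ⟨η₂, hη₂, H₂⟩ := T.exists_near_landing (hIoo b hb) hn' hj hρ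
  obtain ⟨ε, hε, hmatch⟩ := h.exists_matching hρ
  obtain ⟨η₃, hη₃, H₃⟩ := hT.exists_dist_lt
    ⟨a, h.mem_Xbar.2 ⟨p, hp, Ioo_subset_Icc_self ha⟩⟩ hε
  obtain ⟨S, hS, hψ, hφ⟩ := T.exists_near_generic
    (δ := min (min δ η₁) (min η₂ η₃)) (by positivity)
  simp only [lt_min_iff] at hS
  obtain ⟨⟨hSδ, hS₁⟩, hS₂, hS₃⟩ := hS
  obtain ⟨a', haa, ha'⟩ := H₁ S hS₁
  obtain ⟨b', hbb, hb'⟩ := H₂ S hS₂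
  obtain ⟨G, hGcard, hG⟩ := hcard S hSδ
  obtain ⟨q, hq, hq1, hq2⟩ := hmatch S G hG hGcard (H₃ S hS₃).1 (H₃ S hS₃).2 p hp
  rw [abs_lt] at haa hbb
  obtain ⟨φ, hφ0, hφne⟩ := hφ i j hi0 hi1 hj0 hj1 hij
  exact hφne (hG.map_beta_eq_of_landing hφ0 hψ hq ⟨by linarith, by linarith⟩
    ⟨by linarith, by linarith⟩ ha' hb')

end ITM

/-- Let `T ∈ ITM(r)` be stable and satisfy A1 and A2. Then the first return map to every
dynamically non-trivial interval component `J` of `X` has exactly one discontinuity: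
exactly one point of the interior of `J` lands on a discontinuity of `T` before
returning to `J`. -/
theorem returnMap_exactly_one_discontinuity {r : ℕ} (T : ITM r)
    (hstab : T.Stable) (h1 : T.A1) (h2 : T.A2) :
    ∀ J : Set ℝ, T.IsIntervalComponent J → ¬ T.DynTrivial J →
      ∃! a : ℝ, a ∈ interior J ∧ ∃ k < T.returnTime J a, (T.f)^[k] a ∈ T.critSet := by
  obtain ⟨δ, hδ, N, hdec⟩ := hstab.exists_card_decomp
  obtain ⟨F, hF, hT⟩ := hdec T (T.pdist_self_lt hδ)
  intro J hJ hnt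
  obtain ⟨p, hp, rfl⟩ := hT.exists_eq_of_isIntervalComponent hJ
  obtain ⟨a, ha, hal⟩ := hT.exists_landing hp hJ hnt
  refine ⟨a, ⟨ha, hal⟩, fun b hb => ?_⟩
  exact hstab.landing_unique hT hδ (fun S hS => hF.symm ▸ hdec S hS) hp hb.1 ha hb.2 hal
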